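/- arXiv:2402.05638 — 4 statements merged into one kernel-verified Lean document; each statement's English description precedes it below -/
import Mathlib

section
/- For f ∈ cl(CP), the topological entropy of f is zero if and only if either f is the identity map of I or f is topologically conjugate to the map x ↦ 1 − x. In other words, the identity and, up to conjugacy, the map 1 − id are the only maps in cl(CP) with zero topological entropy. -/
open Set Function Metric Dynamics

/-- The unit interval `[0,1]` with the Euclidean metric. -/
abbrev unitI : Type := Set.Icc (0:ℝ) 1

/-- `CP`: continuous surjective self-maps of `I` with a dense set of periodic points.
The ambient space `C(I,I)` carries the uniform (sup) metric. -/
def CP : Set C(unitI, unitI) :=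
  {f | Function.Surjective ⇑f ∧ Dense (Function.periodicPts ⇑f)}

/-- Topological entropy of a self-map of `I` (cover entropy with respect to the
natural uniformity on `I`). -/
noncomputable def hTop (f : unitI → unitI) : EReal :=
  Dynamics.coverEntropy f Set.univ

/-- The map `x ↦ 1 - x` on `I`. -/
def oneMinus : C(unitI, unitI) :=
  ⟨fun x => ⟨1 - x.1, ⟨by linarith [x.2.2], by linarith [x.2.1]⟩⟩, by
    exact Continuous.subtype_mk (by fun_prop) _⟩

/-- `f` is topologically conjugate to `g` via a homeomorphism of `I`. -/
def ConjugateTo (f g : C(unitI, unitI)) : Prop :=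
  ∃ ψ : unitI ≃ₜ unitI, ∀ x, f x = ψ.symm (g (ψ x))

/-! ### Horseshoes and entropy -/

/-- `F` has a horseshoe: two disjoint compact sets, each of which `F` maps over both. -/
def HasHorseshoe {X : Type*} [TopologicalSpace X] (F : X → X) : Prop :=
  ∃ J K : Set X, IsCompact J ∧ IsCompact K ∧ Disjoint J K ∧ J.Nonempty ∧
    J ∪ K ⊆ F '' J ∧ J ∪ K ⊆ F '' K

/-- If `F` maps each of `J`, `K` over both, every itinerary in `J`, `K` is realised. -/
lemma exists_itinerary {X : Type*} {F : X → X} {J K : Set X} (hJ : J.Nonempty)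
    (hFJ : J ∪ K ⊆ F '' J) (hFK : J ∪ K ⊆ F '' K) (n : ℕ) (s : Set ℕ) :
    ∃ x ∈ J ∪ K, ∀ i < n, (i ∈ s → F^[i] x ∈ J) ∧ (i ∉ s → F^[i] x ∈ K) := by
  induction n generalizing s with
  | zero => exact ⟨hJ.some, Or.inl hJ.some_mem, by simp⟩
  | succ n ih =>
    obtain ⟨x, hx, hxs⟩ := ih {i | i + 1 ∈ s}
    by_cases h0 : 0 ∈ s
    · obtain ⟨z, hz, rfl⟩ := hFJ hx
      refine ⟨z, Or.inl hz, fun i hi => ?_⟩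
      cases i with
      | zero => exact ⟨fun _ => hz, fun h => absurd h0 h⟩
      | succ i => simpa using hxs i (by omega)
    · obtain ⟨z, hz, rfl⟩ := hFK hx
      refine ⟨z, Or.inr hz, fun i hi => ?_⟩
      cases i with
      | zero => exact ⟨fun h => absurd h h0, fun _ => hz⟩
      | succ i => simpa using hxs i (by omega)

/-- A map with a horseshoe has nonzero topological entropy. -/
lemma HasHorseshoe.coverEntropy_ne_zero {X : Type*} [UniformSpace X] [T2Space X] {F : X → X}
    (h : HasHorseshoe F) : coverEntropy F univ ≠ 0 := by
  classical
  obtain ⟨J, K, hJc, hKc, hJK, hJ, hFJ, hFK⟩ := h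
  obtain ⟨V, hV, hVd⟩ := hJK.exists_uniform_thickening hJc hKc.isClosed
  have sep : ∀ x ∈ J, ∀ y ∈ K, ∀ z, (x, z) ∈ V → (y, z) ∈ V → False := by
    intro x hx y hy z hxz hyz
    exact Set.disjoint_left.1 hVd (mem_biUnion hx hxz) (mem_biUnion hy hyz)
  have key : ∀ n : ℕ, (2 ^ n : ℕ∞) ≤ netMaxcard F univ V n := by
    intro n
    choose x _ hx using fun s : Finset ℕ => exists_itinerary hJ hFJ hFK n (s : Set ℕ)
    have distinct : ∀ s ∈ (Finset.range n).powerset, ∀ t ∈ (Finset.range n).powerset,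
        ∀ z, z ∈ UniformSpace.ball (x s) (dynEntourage F V n) →
          z ∈ UniformSpace.ball (x t) (dynEntourage F V n) → s = t := by
      intro s hs t ht z hzs hzt
      rw [mem_ball_dynEntourage] at hzs hzt
      rw [Finset.mem_powerset] at hs ht
      ext i
      by_cases hi : i < n
      · by_contra hne
        by_cases his : i ∈ s
        · have hit : i ∉ t := fun h => hne ⟨fun _ => h, fun _ => his⟩
          exact sep _ ((hx s i hi).1 his) _ ((hx t i hi).2 hit) _ (hzs i hi) (hzt i hi)
        · have hit : i ∈ t := by tauto
          exact sep _ ((hx t i hi).1 hit) _ ((hx s i hi).2 his) _ (hzt i hi) (hzs i hi)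
      · exact ⟨fun h => absurd (Finset.mem_range.1 (hs h)) hi,
          fun h => absurd (Finset.mem_range.1 (ht h)) hi⟩
    have self_mem : ∀ y, y ∈ UniformSpace.ball y (dynEntourage F V n) := fun y =>
      mem_ball_dynEntourage.2 fun k _ => refl_mem_uniformity hV
    have inj : Set.InjOn x ((Finset.range n).powerset : Finset (Finset ℕ)) := by
      intro s hs t ht hst
      exact distinct s hs t ht (x s) (self_mem _) (hst ▸ self_mem _)
    have net : IsDynNetIn F univ V n (((Finset.range n).powerset.image x : Finset X) : Set X) := by
      refine ⟨subset_univ _, ?_⟩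
      intro a ha b hb hab
      rw [Finset.mem_coe, Finset.mem_image] at ha hb
      obtain ⟨s, hs, rfl⟩ := ha
      obtain ⟨t, ht, rfl⟩ := hb
      refine Set.disjoint_left.2 fun z hz hz₁ => hab ?_
      rw [distinct s hs t ht z hz hz₁]
    have := net.card_le_netMaxcard
    rw [Finset.card_image_of_injOn inj, Finset.card_powerset, Finset.card_range] at this
    exact_mod_cast this
  have growth : ENNReal.log 2 ≤ coverEntropy F univ := by
    refine le_trans ?_ (netEntropyEntourage_le_coverEntropy F univ hV)
    rw [← ExpGrowth.expGrowthSup_pow]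
    refine ExpGrowth.expGrowthSup_monotone fun n => ?_
    have := ENat.toENNReal_mono (key n)
    simpa using this
  have pos : 0 < ENNReal.log 2 := by
    rw [← ENNReal.log_one]
    exact ENNReal.log_strictMono (by norm_num)
  exact (pos.trans_le growth).ne'

/-- Zero entropy passes to the second iterate. -/
lemma coverEntropy_comp_self_eq_zero {X : Type*} [UniformSpace X] [Nonempty X] {F : X → X}
    (h : coverEntropy F univ = 0) : coverEntropy (F ∘ F) univ = 0 := by
  refine le_antisymm (iSup₂_le fun U hU => ?_) (coverEntropy_nonneg _ univ_nonempty)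
  have hsub : ∀ n, dynEntourage F U (2 * n) ⊆ dynEntourage (F ∘ F) U n := by
    rintro n ⟨x, y⟩ hxy
    rw [mem_dynEntourage] at hxy ⊢
    intro k hk
    have := hxy (2 * k) (by omega)
    rwa [Function.iterate_mul] at this
  have hle : ∀ n, coverMincard (F ∘ F) univ U n ≤ coverMincard F univ U (2 * n) := fun n =>
    biInf_mono fun s hs => SetRel.IsCover.mono_entourage (hsub n) hs
  have hmono : Monotone fun n => (coverMincard F univ U n : ENNReal) := fun _ _ hmn =>
    ENat.toENNReal_mono (coverMincard_monotone_time F univ U hmn)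
  have hU0 : coverEntropyEntourage F univ U = 0 :=
    le_antisymm (h ▸ coverEntropyEntourage_le_coverEntropy F univ hU)
      (coverEntropyEntourage_nonneg F univ_nonempty U)
  calc coverEntropyEntourage (F ∘ F) univ U
      ≤ ExpGrowth.expGrowthSup fun n => (coverMincard F univ U (2 * n) : ENNReal) :=
        ExpGrowth.expGrowthSup_monotone fun n => ENat.toENNReal_mono (hle n)
    _ = (2 : ℕ) * coverEntropyEntourage F univ U := hmono.expGrowthSup_comp_mul two_ne_zero
    _ = 0 := by rw [hU0, mul_zero]

/-- A continuous involution of a compact space has zero entropy. -/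
lemma coverEntropy_eq_zero_of_involutive {X : Type*} [UniformSpace X] [CompactSpace X] [Nonempty X]
    {F : X → X} (hF : Continuous F) (h : Function.Involutive F) : coverEntropy F univ = 0 := by
  refine le_antisymm (iSup₂_le fun U hU => ?_) (coverEntropy_nonneg _ univ_nonempty)
  have hsub : ∀ n, dynEntourage F U 2 ⊆ dynEntourage F U n := by
    rintro n ⟨x, y⟩ hxy
    rw [mem_dynEntourage] at hxy ⊢
    intro k _
    rcases Nat.even_or_odd k with hk | hk
    · simpa [h.iterate_even hk] using hxy 0 (by norm_num)
    · simpa [h.iterate_odd hk] using hxy 1 (by norm_num)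
  have hle : ∀ n, coverMincard F univ U n ≤ coverMincard F univ U 2 := fun n =>
    biInf_mono fun s hs => SetRel.IsCover.mono_entourage (hsub n) hs
  have hfin : coverMincard F univ U 2 < ⊤ := coverMincard_finite_of_isCompact_uniformContinuous
    isCompact_univ (CompactSpace.uniformContinuous_of_continuous hF) hU 2
  have hpos : coverMincard F univ U 2 ≠ 0 := by
    rw [Ne, coverMincard_eq_zero_iff]
    exact univ_nonempty.ne_empty
  refine (ExpGrowth.expGrowthSup_monotone fun n => ENat.toENNReal_mono (hle n)).trans_eq
    (ExpGrowth.expGrowthSup_const ?_ ?_)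
  · simpa using hpos
  · simpa using hfin.ne

/-! ### Self-maps of a compact interval whose orbits flow in both directions -/

section Order

variable {X : Type*} [CompleteLinearOrder X]

/-- Whenever a point `x` moves up, some point above `x` is mapped to or below `x`. -/
def FlowsDown (f : X → X) : Prop := ∀ x, x < f x → ∃ y, x < y ∧ f y ≤ x

/-- Whenever a point `x` moves down, some point below `x` is mapped to or above `x`. -/
def FlowsUp (f : X → X) : Prop := ∀ x, f x < x → ∃ y, y < x ∧ x ≤ f y

variable [TopologicalSpace X] [OrderTopology X] [DenselyOrdered X] {f : X → X}

lemma FlowsDown.exists_le_of_lt (h : FlowsDown f) (hf : Continuous f) {c x : X} (hcx : c ≤ x)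
    (hc : f c ≤ c) (hx : x < f x) :
    ∃ p, c ≤ p ∧ p < x ∧ f p ≤ p ∧ ∃ y, x < y ∧ f y ≤ p := by
  have hcomp : IsCompact (Icc c x ∩ {t | f t ≤ t}) :=
    isCompact_Icc.inter_right (isClosed_le hf continuous_id)
  obtain ⟨p, ⟨⟨hcp, hpx⟩, hp⟩, hpmax⟩ := hcomp.exists_isGreatest ⟨c, ⟨le_rfl, hcx⟩, hc⟩
  have hp : f p ≤ p := hp
  have hpx₁ : p < x := lt_of_le_of_ne hpx (by rintro rfl; exact absurd hx hp.not_gt)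
  obtain ⟨y, hy, hymin⟩ := (isClosed_Ici (a := x)).isCompact.exists_isMinOn nonempty_Ici
    hf.continuousOn
  have hyp : f y ≤ p := by
    by_contra! hlt
    obtain ⟨t, hpt, htlt⟩ := exists_between (lt_min hlt hpx₁)
    have hty : t < f y := htlt.trans_le (min_le_left _ _)
    have htx : t < x := htlt.trans_le (min_le_right _ _)
    have htf : t < f t := by
      by_contra! h₁
      exact absurd (hpmax ⟨⟨hcp.trans hpt.le, htx.le⟩, h₁⟩) hpt.not_ge
    obtain ⟨u, htu, hu⟩ := h t htf
    rcases le_or_gt u x with hux | hux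
    · have := hpmax ⟨⟨hcp.trans (hpt.trans htu).le, hux⟩, hu.trans htu.le⟩
      exact absurd this (hpt.trans htu).not_ge
    · exact absurd ((isMinOn_iff.1 hymin u hux.le).trans hu) hty.not_ge
  refine ⟨p, hcp, hpx₁, hp, y, lt_of_le_of_ne hy ?_, hyp⟩
  rintro rfl
  exact absurd hx (hyp.trans hpx).not_gt

lemma FlowsUp.exists_ge_of_lt (h : FlowsUp f) (hf : Continuous f) {c x : X} (hcx : x ≤ c)
    (hc : c ≤ f c) (hx : f x < x) :
    ∃ r, r ≤ c ∧ x < r ∧ r ≤ f r ∧ ∃ y, y < x ∧ r ≤ f y :=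
  FlowsDown.exists_le_of_lt (X := Xᵒᵈ) (f := f) h hf hcx hc hx

/-- If `p` does not move up, `f w` is at least `y` and `f y` at most `p`, where `p < w < y`, then
`[p, w]` and `[w, y]` are each mapped over `[p, y]`. -/
lemma hasHorseshoe_of_fold (hf : Continuous f) {p w y : X} (hpw : p < w) (hwy : w < y)
    (hp : f p ≤ p) (hw : y ≤ f w) (hy : f y ≤ p) : HasHorseshoe (f ∘ f) := by
  have hleft : Icc p y ⊆ f '' Icc p w :=
    (Icc_subset_Icc hp hw).trans (intermediate_value_Icc hpw.le hf.continuousOn)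
  have hright : Icc p y ⊆ f '' Icc w y :=
    (Icc_subset_Icc hy hw).trans (intermediate_value_Icc' hwy.le hf.continuousOn)
  have hsub : Icc p w ⊆ Icc p y := Icc_subset_Icc le_rfl hwy.le
  have hclosed : IsClosed (f ⁻¹' Icc p w) := isClosed_Icc.preimage hf
  have hJ : Icc p y ⊆ (f ∘ f) '' (Icc p w ∩ f ⁻¹' Icc p w) := by
    intro z hz
    obtain ⟨u, hu, rfl⟩ := hleft hz
    obtain ⟨t, ht, rfl⟩ := hleft (hsub hu)
    exact ⟨t, ⟨ht, hu⟩, rfl⟩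
  have hK : Icc p y ⊆ (f ∘ f) '' (Icc w y ∩ f ⁻¹' Icc p w) := by
    intro z hz
    obtain ⟨u, hu, rfl⟩ := hleft hz
    obtain ⟨t, ht, rfl⟩ := hright (hsub hu)
    exact ⟨t, ⟨ht, hu⟩, rfl⟩
  have hJK : (Icc p w ∩ f ⁻¹' Icc p w) ∪ (Icc w y ∩ f ⁻¹' Icc p w) ⊆ Icc p y :=
    union_subset (inter_subset_left.trans hsub)
      (inter_subset_left.trans (Icc_subset_Icc hpw.le le_rfl))
  refine ⟨_, _, isCompact_Icc.inter_right hclosed, isCompact_Icc.inter_right hclosed, ?_, ?_,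
    hJK.trans hJ, hJK.trans hK⟩
  · refine Set.disjoint_left.2 ?_
    rintro t ⟨ht, htf⟩ ⟨ht₁, -⟩
    obtain rfl : t = w := le_antisymm ht.2 ht₁.1
    exact absurd (htf.2.trans_lt hwy) hw.not_gt
  · obtain ⟨t, ht, -⟩ := hJ (left_mem_Icc.2 (hpw.trans hwy).le)
    exact ⟨t, ht⟩

lemma hasHorseshoe_of_fold_dual (hf : Continuous f) {w y r : X} (hwy : w < y) (hyr : y < r)
    (hr : r ≤ f r) (hy : f y ≤ w) (hw : r ≤ f w) : HasHorseshoe (f ∘ f) :=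
  hasHorseshoe_of_fold (X := Xᵒᵈ) (f := f) hf hyr hwy hr hy hw

lemma hasHorseshoe_of_map_bot (hf : Continuous f) (hd : FlowsDown f) (hu : FlowsUp f)
    (hbot : f ⊥ = ⊥) (hne : f ≠ id) : HasHorseshoe (f ∘ f) := by
  obtain ⟨x, hx⟩ : ∃ x, x < f x := by
    obtain ⟨x, hx⟩ := Function.ne_iff.1 hne
    rcases lt_or_gt_of_ne hx with h | h
    · obtain ⟨y, hyx, hy⟩ := hu x h
      exact ⟨y, hyx.trans_le hy⟩
    · exact ⟨x, h⟩
  obtain ⟨p₀, -, hp₀x, hp₀, y₀, hxy₀, hy₀⟩ := hd.exists_le_of_lt hf bot_le hbot.le hx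
  have hclosed : IsClosed {q : X × X | f q.1 ≤ q.1 ∧ f q.2 ≤ q.1 ∧ y₀ ≤ q.2} :=
    (isClosed_le (hf.comp continuous_fst) continuous_fst).inter
      ((isClosed_le (hf.comp continuous_snd) continuous_fst).inter
        (isClosed_le continuous_const continuous_snd))
  obtain ⟨⟨p, y⟩, ⟨hp, hyp, hyy₀⟩, hmin⟩ := hclosed.isCompact.exists_isMinOn
    ⟨(p₀, y₀), hp₀, hy₀, le_rfl⟩ continuous_fst.continuousOn
  dsimp only at hp hyp hyy₀
  rw [isMinOn_iff] at hmin
  have hpy : p < y :=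
    ((hmin (p₀, y₀) ⟨hp₀, hy₀, le_rfl⟩).trans_lt (hp₀x.trans hxy₀)).trans_le hyy₀
  obtain ⟨w, hwy, hw⟩ := hu y (hyp.trans_lt hpy)
  rcases lt_trichotomy p w with hpw | rfl | hwp
  · exact hasHorseshoe_of_fold hf hpw hwy hp hw hyp
  · exact absurd (hp.trans_lt hpy) hw.not_gt
  · obtain ⟨p₁, -, hpw₁, hp₁, y₁, hwy₁, hy₁⟩ :=
      hd.exists_le_of_lt hf bot_le hbot.le (hwy.trans_le hw)
    have hy₁y : y₁ < y := by
      by_contra! hle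
      exact absurd (hmin (p₁, y₁) ⟨hp₁, hy₁, hyy₀.trans hle⟩) (hpw₁.trans hwp).not_ge
    exact hasHorseshoe_of_fold hf hpw₁ hwy₁ hp₁ (hy₁y.le.trans hw) hy₁

lemma FlowsUp.fixedPt_lt_of_map_eq_bot (hu : FlowsUp f) (hf : Continuous f)
    (hH : ¬ HasHorseshoe (f ∘ f)) (hbot : f ⊥ ≠ ⊥) {c y : X} (hc : f c = c) (hy : f y = ⊥) :
    c < y := by
  by_contra! hyc
  have hyne : y ≠ ⊥ := by rintro rfl; exact hbot hy
  obtain ⟨r, -, hyr, hr, w, hwy, hw⟩ :=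
    hu.exists_ge_of_lt hf hyc hc.ge (hy.trans_lt (bot_lt_iff_ne_bot.2 hyne))
  exact hH (hasHorseshoe_of_fold_dual hf hwy hyr hr (hy.trans_le bot_le) hw)

lemma FlowsDown.lt_fixedPt_of_map_eq_top (hd : FlowsDown f) (hf : Continuous f)
    (hH : ¬ HasHorseshoe (f ∘ f)) (htop : f ⊤ ≠ ⊤) {c w : X} (hc : f c = c) (hw : f w = ⊤) :
    w < c :=
  FlowsUp.fixedPt_lt_of_map_eq_bot (X := Xᵒᵈ) (f := f) hd hf hH htop hc hw

lemma exists_map_eq_top_and_bot_around_fixedPt (hf : Continuous f) (hs : Function.Surjective f)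
    (hd : FlowsDown f) (hu : FlowsUp f) (hH : ¬ HasHorseshoe (f ∘ f)) (hne : f ≠ id) {c : X}
    (hc : f c = c) : ∃ w y, w < c ∧ c < y ∧ f w = ⊤ ∧ f y = ⊥ := by
  have hbot : f ⊥ ≠ ⊥ := fun h => hH (hasHorseshoe_of_map_bot hf hd hu h hne)
  obtain ⟨y, hy⟩ := hs ⊥
  obtain ⟨w, hw⟩ := hs ⊤
  have htop : f ⊤ ≠ ⊤ := fun h => not_top_lt (hu.fixedPt_lt_of_map_eq_bot hf hH hbot h hy)
  exact ⟨w, y, hd.lt_fixedPt_of_map_eq_top hf hH htop hc hw,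
    hu.fixedPt_lt_of_map_eq_bot hf hH hbot hc hy, hw, hy⟩

/-- A surjective map whose first two iterates flow in both directions, and whose second and fourth
iterates have no horseshoe, is an involution. -/
lemma involutive_of_not_hasHorseshoe (hf : Continuous f) (hs : Function.Surjective f)
    (hd : FlowsDown f) (hu : FlowsUp f) (hd₂ : FlowsDown (f ∘ f)) (hu₂ : FlowsUp (f ∘ f))
    (hH : ¬ HasHorseshoe (f ∘ f)) (hH₂ : ¬ HasHorseshoe ((f ∘ f) ∘ (f ∘ f))) :
    Function.Involutive f := by
  by_contra hinv
  have hne₂ : f ∘ f ≠ id := fun h => hinv fun x => congrFun h x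
  have hne : f ≠ id := by rintro rfl; exact hne₂ rfl
  obtain ⟨c, -, hc⟩ := exists_mem_Icc_isFixedPt (a := ⊥) (b := ⊤) hf.continuousOn bot_le bot_le
    le_top
  have hc : f c = c := hc
  have hc₂ : (f ∘ f) c = c := by simp [hc]
  have hf₂ : Continuous (f ∘ f) := hf.comp hf
  obtain ⟨w, y, hwc, hcy, hw, hy⟩ :=
    exists_map_eq_top_and_bot_around_fixedPt hf hs hd hu hH hne hc
  obtain ⟨w₂, y₂, hwc₂, hcy₂, hw₂, hy₂⟩ :=
    exists_map_eq_top_and_bot_around_fixedPt hf₂ (hs.comp hs) hd₂ hu₂ hH₂ hne₂ hc₂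
  obtain ⟨z, hz, hz₂⟩ : ∃ z ∈ Icc w c, (f ∘ f) z = ⊥ := by
    have : y ∈ Icc (f c) (f w) := ⟨hc.trans_le hcy.le, hw ▸ le_top⟩
    obtain ⟨z, hz, hzy⟩ := intermediate_value_Icc' hwc.le hf.continuousOn this
    exact ⟨z, hz, by simp [hzy, hy]⟩
  obtain ⟨z₁, hz₁, hz₁₂⟩ : ∃ z ∈ Icc c y, (f ∘ f) z = ⊤ := by
    have : w ∈ Icc (f y) (f c) := ⟨hy ▸ bot_le, hwc.le.trans hc.ge⟩
    obtain ⟨z, hz, hzw⟩ := intermediate_value_Icc' hcy.le hf.continuousOn this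
    exact ⟨z, hz, by simp [hzw, hw]⟩
  have hzc : z < c := lt_of_le_of_ne hz.2 (by
    rintro rfl
    exact absurd (hc₂.symm.trans hz₂) (bot_le.trans_lt hwc).ne')
  have hcz₁ : c < z₁ := lt_of_le_of_ne hz₁.1 (by
    rintro rfl
    exact absurd (hc₂.symm.trans hz₁₂) (hcy.trans_le le_top).ne)
  rcases lt_or_ge w₂ z with hwz | hzw
  · exact hH₂ (hasHorseshoe_of_fold_dual hf₂ hwz hzc hc₂.ge (hz₂.trans_le bot_le)
      (le_top.trans hw₂.ge))
  rcases lt_or_ge z₁ y₂ with hzy | hyz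
  · exact hH₂ (hasHorseshoe_of_fold hf₂ hcz₁ hzy hc₂.le (le_top.trans hz₁₂.ge)
      (hy₂.trans_le bot_le))
  refine hH ⟨Icc z w₂, Icc y₂ z₁, isCompact_Icc, isCompact_Icc, ?_, nonempty_Icc.2 hzw, ?_, ?_⟩
  · exact Set.disjoint_left.2 fun t ht ht₁ =>
      absurd (ht.2.trans_lt (hwc₂.trans hcy₂)) ht₁.1.not_gt
  · intro t _
    exact intermediate_value_Icc hzw hf₂.continuousOn ⟨hz₂.trans_le bot_le, le_top.trans hw₂.ge⟩
  · intro t _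
    exact intermediate_value_Icc hyz hf₂.continuousOn ⟨hy₂.trans_le bot_le, le_top.trans hz₁₂.ge⟩

end Order

/-! ### The closure of `CP` -/

/-- A map in the closure of `CP` cannot push a compact set `C` into an open part of `C` that misses
a nonempty open part of `C`. -/
lemma eq_empty_of_mapsTo_of_mem_closure_CP {f : C(unitI, unitI)} (hf : f ∈ closure CP)
    {C U V : Set unitI} (hC : IsCompact C) (hU : IsOpen U) (hUC : U ⊆ C) (hV : IsOpen V)
    (hVC : V ⊆ C) (hUV : Disjoint U V) (hmaps : MapsTo f C U) : V = ∅ := by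
  by_contra hne
  obtain ⟨g, hg, -, hgper⟩ :=
    mem_closure_iff.1 hf _ (ContinuousMap.isOpen_setOfPred_mapsTo hC hU) hmaps
  obtain ⟨v, hvV, n, hn, hv⟩ := hgper.inter_open_nonempty V hV (nonempty_iff_ne_empty.2 hne)
  have hg : MapsTo g C U := hg
  have hgC : MapsTo g C C := fun x hx => hUC (hg hx)
  obtain ⟨m, rfl⟩ := Nat.exists_eq_succ_of_ne_zero hn.ne'
  have hvU : g^[m + 1] v ∈ U := by
    rw [Function.iterate_succ_apply']
    exact hg (hgC.iterate m (hVC hvV))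
  rw [hv.eq] at hvU
  exact Set.disjoint_left.1 hUV hvU hvV

lemma flowsDown_of_mem_closure_CP {f : C(unitI, unitI)} (hf : f ∈ closure CP) :
    FlowsDown (f : unitI → unitI) := by
  intro x hx
  by_contra! hno
  obtain ⟨y, hy, hymin⟩ := (isClosed_Ici (a := x)).isCompact.exists_isMinOn nonempty_Ici
    f.continuous.continuousOn
  have hxy : x < f y := by
    rcases eq_or_lt_of_le (show x ≤ y from hy) with rfl | h
    exacts [hx, hno y h]
  obtain ⟨t, hxt, hty⟩ := exists_between hxy
  have hempty := eq_empty_of_mapsTo_of_mem_closure_CP hf (isClosed_Ici (a := x)).isCompact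
    (isOpen_Ioi (a := t)) (fun u hu => (hxt.trans hu).le) (isOpen_Ioo (a := x) (b := t))
    (fun u hu => hu.1.le) (Set.disjoint_left.2 fun u hu hu₁ => lt_asymm hu hu₁.2)
    (fun u hu => hty.trans_le (isMinOn_iff.1 hymin u hu))
  exact (nonempty_Ioo.2 hxt).ne_empty hempty

lemma flowsUp_of_mem_closure_CP {f : C(unitI, unitI)} (hf : f ∈ closure CP) :
    FlowsUp (f : unitI → unitI) := by
  intro x hx
  by_contra! hno
  obtain ⟨y, hy, hymax⟩ := (isClosed_Iic (a := x)).isCompact.exists_isMaxOn nonempty_Iic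
    f.continuous.continuousOn
  have hxy : f y < x := by
    rcases eq_or_lt_of_le (show y ≤ x from hy) with rfl | h
    exacts [hx, hno y h]
  obtain ⟨t, hyt, htx⟩ := exists_between hxy
  have hempty := eq_empty_of_mapsTo_of_mem_closure_CP hf (isClosed_Iic (a := x)).isCompact
    (isOpen_Iio (a := t)) (fun u hu => (lt_trans hu htx).le) (isOpen_Ioo (a := t) (b := x))
    (fun u hu => hu.2.le) (Set.disjoint_left.2 fun u hu hu₁ => lt_asymm hu hu₁.1)
    (fun u hu => (isMaxOn_iff.1 hymax u hu).trans_lt hyt)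
  exact (nonempty_Ioo.2 htx).ne_empty hempty

lemma comp_self_mem_closure_CP {f : C(unitI, unitI)} (hf : f ∈ closure CP) :
    f.comp f ∈ closure CP := by
  have hcont : Continuous fun g : C(unitI, unitI) => g.comp g := continuous_id.compCM continuous_id
  refine map_mem_closure (f := fun g : C(unitI, unitI) => g.comp g) hcont hf ?_
  rintro g ⟨hgs, hgp⟩
  refine ⟨hgs.comp hgs, hgp.mono ?_⟩
  rintro x ⟨n, hn, hx⟩
  exact ⟨n, hn, hx.iterate 2⟩

lemma surjective_of_mem_closure_CP {f : C(unitI, unitI)} (hf : f ∈ closure CP) :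
    Function.Surjective f := by
  intro z
  by_contra! hz
  obtain ⟨g, hg, hgs, -⟩ := mem_closure_iff.1 hf _
    (ContinuousMap.isOpen_setOfPred_mapsTo isCompact_univ (isOpen_compl_singleton (x := z)))
    (fun x _ => hz x)
  obtain ⟨x, hx⟩ := hgs z
  exact hg (mem_univ x) hx

/-- A continuous involution of the interval is the identity or conjugate to `x ↦ 1 - x`. -/
lemma eq_id_or_conjugateTo_oneMinus_of_involutive {f : C(unitI, unitI)}
    (hf : Function.Involutive f) : f = ContinuousMap.id unitI ∨ ConjugateTo f oneMinus := by
  rcases f.continuous.strictMono_of_inj hf.injective with hmono | hanti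
  · left
    ext1 x
    rcases lt_trichotomy (f x) x with h | h | h
    · have := hmono h
      rw [hf x] at this
      exact absurd h this.not_gt
    · exact h
    · have := hmono h
      rw [hf x] at this
      exact absurd h this.not_gt
  · right
    let φ : unitI → unitI := fun x => ⟨(x.1 + (1 - (f x).1)) / 2,
      by linarith [x.2.1, (f x).2.2], by linarith [x.2.2, (f x).2.1]⟩
    have hφc : Continuous φ := by
      refine Continuous.subtype_mk ?_ _
      fun_prop
    have hφm : StrictMono φ := by
      intro x y hxy
      have h1 : x.1 < y.1 := hxy
      have h2 : (f y).1 < (f x).1 := hanti hxy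
      change (x.1 + (1 - (f x).1)) / 2 < (y.1 + (1 - (f y).1)) / 2
      linarith
    have hbot : f ⊥ = ⊤ := top_le_iff.1 (by
      have := hanti.antitone (bot_le : ⊥ ≤ f ⊤)
      rwa [hf] at this)
    have htop : f ⊤ = ⊥ := by rw [← hbot, hf]
    have hφs : Function.Surjective φ := by
      intro z
      refine mem_range_of_exists_le_of_exists_ge hφc ⟨⊥, ?_⟩ ⟨⊤, ?_⟩
      · have : φ ⊥ = ⊥ := Subtype.ext (by
          change ((0 : ℝ) + (1 - (f ⊥).1)) / 2 = 0
          rw [hbot]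
          change ((0 : ℝ) + (1 - 1)) / 2 = 0
          norm_num)
        exact this.le.trans bot_le
      · have : φ ⊤ = ⊤ := Subtype.ext (by
          change ((1 : ℝ) + (1 - (f ⊤).1)) / 2 = 1
          rw [htop]
          change ((1 : ℝ) + (1 - 0)) / 2 = 1
          norm_num)
        exact le_top.trans this.ge
    let ψ : unitI ≃ₜ unitI := Continuous.homeoOfEquivCompactToT2
      (f := Equiv.ofBijective φ ⟨hφm.injective, hφs⟩) hφc
    refine ⟨ψ, fun x => ?_⟩
    rw [Homeomorph.eq_symm_apply]
    refine Subtype.ext ?_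
    change ((f x).1 + (1 - (f (f x)).1)) / 2 = 1 - (x.1 + (1 - (f x).1)) / 2
    rw [hf x]
    ring

lemma ConjugateTo.involutive {f : C(unitI, unitI)} (h : ConjugateTo f oneMinus) :
    Function.Involutive f := by
  obtain ⟨ψ, hψ⟩ := h
  have hσ : ∀ x, oneMinus (oneMinus x) = x := fun x => Subtype.ext (sub_sub_cancel 1 x.1)
  intro x
  rw [hψ (f x), hψ x, Homeomorph.apply_symm_apply, hσ, Homeomorph.symm_apply_apply]

/-- For `f` in the closure of `CP`, the topological entropy of `f` is zero if and only
if `f` is the identity or `f` is topologically conjugate to `x ↦ 1 - x`. -/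
theorem entropy_zero_iff_id_or_conj_oneMinus (f : C(unitI, unitI))
    (hf : f ∈ closure CP) :
    hTop ⇑f = 0 ↔ (f = ContinuousMap.id unitI ∨ ConjugateTo f oneMinus) := by
  constructor
  · intro h
    have h₂ : coverEntropy (f ∘ f) univ = 0 := coverEntropy_comp_self_eq_zero h
    have hf₂ := comp_self_mem_closure_CP hf
    exact eq_id_or_conjugateTo_oneMinus_of_involutive <|
      involutive_of_not_hasHorseshoe f.continuous (surjective_of_mem_closure_CP hf)
        (flowsDown_of_mem_closure_CP hf) (flowsUp_of_mem_closure_CP hf)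
        (flowsDown_of_mem_closure_CP hf₂) (flowsUp_of_mem_closure_CP hf₂)
        (fun hH => hH.coverEntropy_ne_zero h₂)
        (fun hH => hH.coverEntropy_ne_zero (coverEntropy_comp_self_eq_zero h₂))
  · rintro (rfl | h)
    · exact coverEntropy_eq_zero_of_involutive continuous_id fun _ => rfl
    · exact coverEntropy_eq_zero_of_involutive f.continuous h.involutive
end

section
/- CP is a residual subset of cl(CP): there is a dense G_δ subset of the complete metric space (cl(CP), ρ) contained in CP. -/
open Set Function Metric

open Filter Topology

section OneDimensionalDynamics

variable {X : Type*} [TopologicalSpace X]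

/-- A continuous self-map of a compact Hausdorff space with dense periodic points is onto. -/
theorem surjective_of_dense_periodicPts [CompactSpace X] [T2Space X] {f : X → X}
    (hf : Continuous f) (hd : Dense (periodicPts f)) : Surjective f := by
  have hsub : periodicPts f ⊆ range f := by
    rintro x ⟨n, hn, hx⟩
    obtain ⟨m, rfl⟩ := Nat.exists_eq_succ_of_ne_zero hn.ne'
    exact ⟨f^[m] x, by rw [← iterate_succ_apply' f]; exact hx⟩
  have hc : IsClosed (range f) := (isCompact_range hf).isClosed
  exact range_eq_univ.1 (hc.closure_eq ▸ (hd.mono hsub).closure_eq)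

/-- Some iterate of `f` moves a point of `U` down and a point of `U` up. -/
def HasCrossing [LinearOrder X] (f : X → X) (U : Set X) : Prop :=
  ∃ n : ℕ, ∃ a ∈ U, ∃ b ∈ U, f^[n] a < a ∧ b < f^[n] b

variable [LinearOrder X] [OrderTopology X]

theorem HasCrossing.exists_periodicPt {f : X → X} (hf : Continuous f) {U : Set X}
    (hU : IsPreconnected U) (h : HasCrossing f U) :
    ∃ x ∈ U, x ∈ periodicPts f := by
  obtain ⟨n, a, ha, b, hb, hfa, hfb⟩ := h
  obtain ⟨x, hxU, hx⟩ := hU.intermediate_value₂ ha hb (hf.iterate n).continuousOn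
    continuousOn_id hfa.le hfb.le
  refine ⟨x, hxU, n, Nat.pos_of_ne_zero ?_, hx⟩
  rintro rfl
  exact lt_irrefl _ hfa

/-- If some iterate of `f` is the identity on a subinterval, then on a smaller subinterval all
points have the same minimal period. -/
theorem exists_Ioo_iterate_eq_id_and_ne {f : X → X} (hf : Continuous f) {U : Set X}
    (h : ∃ n > 0, ∃ u v, u < v ∧ Ioo u v ⊆ U ∧ ∀ x ∈ Ioo u v, f^[n] x = x) :
    ∃ n > 0, ∃ u v, u < v ∧ Ioo u v ⊆ U ∧ (∀ x ∈ Ioo u v, f^[n] x = x) ∧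
      ∀ x ∈ Ioo u v, ∀ i, 0 < i → i < n → f^[i] x ≠ x := by
  classical
  obtain ⟨hn, u, v, huv, hU, hid⟩ := Nat.find_spec h
  have hmin := fun m => Nat.find_min h (m := m)
  set n := Nat.find h
  have : Nontrivial X := ⟨u, v, huv.ne⟩
  have key : ∀ k ≤ n, ∃ a b, a < b ∧ Ioo a b ⊆ Ioo u v ∧
      ∀ x ∈ Ioo a b, ∀ i, 0 < i → i < k → f^[i] x ≠ x := by
    intro k
    induction k with
    | zero => exact fun _ => ⟨u, v, huv, Subset.rfl, by simp⟩
    | succ k ih =>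
      intro hk
      obtain ⟨a, b, hab, hsub, hne⟩ := ih (by omega)
      obtain rfl | hk0 := Nat.eq_zero_or_pos k
      · exact ⟨a, b, hab, hsub, fun x _ i h0 h1 => by omega⟩
      obtain ⟨x, hx, hxne⟩ : ∃ x ∈ Ioo a b, f^[k] x ≠ x := by
        by_contra! hcon
        exact hmin k hk ⟨hk0, a, b, hab, hsub.trans hU, hcon⟩
      have hopen : IsOpen (Ioo a b ∩ {x | f^[k] x ≠ x}) :=
        isOpen_Ioo.inter (isOpen_ne_fun (hf.iterate k) continuous_id)
      obtain ⟨a', b', hab', hsub'⟩ := hopen.exists_Ioo_subset ⟨x, hx, hxne⟩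
      refine ⟨a', b', hab', fun y hy => hsub (hsub' hy).1, fun y hy i h0 hi => ?_⟩
      obtain hlt | rfl := (Nat.lt_succ_iff.1 hi).lt_or_eq
      · exact hne y (hsub' hy).1 i h0 hlt
      · exact (hsub' hy).2
  obtain ⟨a, b, hab, hsub, hne⟩ := key n le_rfl
  exact ⟨n, hn, a, b, hab, hsub.trans hU, fun x hx => hid x (hsub hx), hne⟩

variable [DenselyOrdered X] [CompactIccSpace X]

theorem hasCrossing_of_fixed_lt_of_lt_iterate {f : X → X} (hf : Continuous f)
    (hd : Dense (periodicPts f)) {p q : X} {n : ℕ} (hpq : p < q)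
    (hp : f^[n] p = p) (hq : q < f^[n] q) : HasCrossing f (Ico p q) := by
  set g := f^[n] with hg
  have hgc : Continuous g := hf.iterate n
  have hK : IsCompact (Icc p q ∩ {x | g x ≤ x}) :=
    isCompact_Icc.inter_right (isClosed_le hgc continuous_id)
  obtain ⟨c, ⟨⟨hpc, hcq⟩, hgc_le⟩, hmax⟩ :=
    hK.exists_isGreatest ⟨p, left_mem_Icc.2 hpq.le, hp.le⟩
  have hcq' : c < q := lt_of_le_of_ne hcq (by rintro rfl; exact absurd hq (not_lt.2 hgc_le))
  have hup : ∀ x, c < x → x < q → x < g x := fun x hcx hxq => by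
    by_contra hx
    exact absurd (hmax ⟨⟨hpc.trans hcx.le, hxq.le⟩, not_lt.1 hx⟩) (not_le.2 hcx)
  have hIoo : ∀ᶠ x in 𝓝[>] c, x ∈ Ioo c q := Ioo_mem_nhdsGT hcq'
  have : (𝓝[>] c).NeBot := nhdsGT_neBot_of_exists_gt ⟨q, hcq'⟩
  have hgcc : g c = c := by
    refine le_antisymm hgc_le (not_lt.1 fun hlt => ?_)
    have h1 : ∀ᶠ x in 𝓝[>] c, g x < x :=
      nhdsWithin_le_nhds ((isOpen_lt hgc continuous_id).mem_nhds hlt)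
    obtain ⟨x, hx, hxI⟩ := (h1.and hIoo).exists
    exact lt_asymm hx (hup x hxI.1 hxI.2)
  have hup' : ∀ᶠ x in 𝓝[>] c, x < g x := hIoo.mono fun x hx => hup x hx.1 hx.2
  have htend : Tendsto g (𝓝[>] c) (𝓝[>] c) := by
    refine tendsto_nhdsWithin_iff.2 ⟨?_, ?_⟩
    · have := hgc.tendsto c
      rw [hgcc] at this
      exact this.mono_left nhdsWithin_le_nhds
    · filter_upwards [hup', hIoo] with x hx hxI using hxI.1.trans hx
  have hiter : ∀ k : ℕ, ∀ᶠ x in 𝓝[>] c, x < g^[k + 1] x := by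
    intro k
    induction k with
    | zero => simpa using hup'
    | succ k ih =>
      filter_upwards [ih, (htend.iterate (k + 1)).eventually hup'] with x hx hx'
      rw [iterate_succ_apply' g]
      exact hx.trans hx'
  obtain ⟨d, hd', hsub⟩ := (mem_nhdsGT_iff_exists_Ioo_subset' hcq').1
    (hIoo.and (htend.eventually hIoo))
  obtain ⟨r, hrI, m, hm, hr⟩ := hd.inter_open_nonempty _ isOpen_Ioo (nonempty_Ioo.2 hd')
  obtain ⟨hrq, hgr⟩ := hsub hrI
  have hrg : r < g r := hup r hrq.1 hrq.2
  have hgm : g^[m] r = r := by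
    rw [hg, ← iterate_mul, mul_comm]
    exact hr.mul_const n
  obtain _ | _ | k := m
  · exact absurd hm (lt_irrefl _)
  · exact absurd hgm hrg.ne'
  obtain ⟨y, hy, hyI⟩ := ((hiter k).and hIoo).exists
  refine ⟨n * (k + 1), g r, ⟨hpc.trans hgr.1.le, hgr.2⟩, y, ⟨hpc.trans hyI.1.le, hyI.2⟩, ?_, ?_⟩
  · rw [iterate_mul, ← hg, ← iterate_succ_apply g, hgm]
    exact hrg
  · rw [iterate_mul, ← hg]
    exact hy

theorem hasCrossing_of_lt_fixed_of_iterate_lt {f : X → X} (hf : Continuous f)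
    (hd : Dense (periodicPts f)) {p q : X} {n : ℕ} (hqp : q < p)
    (hp : f^[n] p = p) (hq : f^[n] q < q) : HasCrossing f (Ioc q p) := by
  obtain ⟨N, a, ha, b, hb, h1, h2⟩ := hasCrossing_of_fixed_lt_of_lt_iterate
    (X := Xᵒᵈ) (f := f) hf hd (p := p) (q := q) (n := n) hqp hp hq
  exact ⟨N, b, ⟨hb.2, hb.1⟩, a, ⟨ha.2, ha.1⟩, h2, h1⟩

/-- A map with dense periodic points that has no crossing in an interval has an iterate equal to
the identity on some subinterval. -/
theorem exists_iterate_eq_id_of_not_hasCrossing {f : X → X} (hf : Continuous f)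
    (hd : Dense (periodicPts f)) {u v : X} (huv : u < v) (h : ¬ HasCrossing f (Ioo u v)) :
    ∃ n > 0, ∃ u' v', u' < v' ∧ Ioo u' v' ⊆ Ioo u v ∧ ∀ x ∈ Ioo u' v', f^[n] x = x := by
  obtain ⟨p, ⟨hup, hpv⟩, n, hn, hp⟩ :=
    hd.inter_open_nonempty _ isOpen_Ioo (nonempty_Ioo.2 huv)
  have hmono : ∀ {s : Set X}, s ⊆ Ioo u v → ¬ HasCrossing f s :=
    fun hs ⟨N, a, ha, b, hb, hab⟩ => h ⟨N, a, hs ha, b, hs hb, hab⟩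
  have hright : ∀ q ∈ Ioo p v, f^[n] q ≤ q := fun q hq => not_lt.1 fun hlt =>
    hmono (fun x hx => ⟨hup.trans_le hx.1, hx.2.trans hq.2⟩)
      (hasCrossing_of_fixed_lt_of_lt_iterate hf hd hq.1 hp hlt)
  have hleft : ∀ q ∈ Ioo u p, q ≤ f^[n] q := fun q hq => not_lt.1 fun hlt =>
    hmono (fun x hx => ⟨hq.1.trans hx.1, hx.2.trans_lt hpv⟩)
      (hasCrossing_of_lt_fixed_of_iterate_lt hf hd hq.2 hp hlt)
  by_cases hall : ∀ q ∈ Ioo p v, f^[n] q = q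
  · exact ⟨n, hn, p, v, hpv, Ioo_subset_Ioo_left hup.le, hall⟩
  · push Not at hall
    obtain ⟨a, ha, hane⟩ := hall
    refine ⟨n, hn, u, p, hup, Ioo_subset_Ioo_right hpv.le, fun b hb => ?_⟩
    refine le_antisymm (not_lt.1 fun hlt => h ?_) (hleft b hb)
    exact ⟨n, a, ⟨hup.trans ha.1, ha.2⟩, b, ⟨hb.1, hb.2.trans hpv⟩,
      lt_of_le_of_ne (hright a ha) hane, hlt⟩

end OneDimensionalDynamics

section LocalPerturbation

variable {X : Type*} {f φ : X → X} {J : Set X} {n : ℕ}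

theorem iterate_comp_apply_of_mem (hret : ∀ x ∈ J, ∀ i, 0 < i → i < n → f^[i] x ∉ J)
    (hout : ∀ x ∉ J, φ x = x) (hJ : MapsTo φ J J) {x : X} (hx : x ∈ J) {i : ℕ}
    (h0 : 0 < i) (hi : i ≤ n) : (f ∘ φ)^[i] x = f^[i] (φ x) := by
  induction i, h0 using Nat.le_induction with
  | base => rfl
  | succ i h0 ih =>
    rw [iterate_succ_apply' (f ∘ φ), ih (by omega), iterate_succ_apply' f, comp_apply,
      hout _ (hret _ (hJ hx) i h0 (by omega))]

/-- Composing `f` with a map `φ` supported on a set `J` of points of equal period, and with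
dense periodic points there, preserves density of periodic points. -/
theorem dense_periodicPts_comp [TopologicalSpace X] (hf : Continuous f)
    (hd : Dense (periodicPts f)) (hn : 0 < n) (hid : ∀ x ∈ J, f^[n] x = x)
    (hret : ∀ x ∈ J, ∀ i, 0 < i → i < n → f^[i] x ∉ J)
    (hout : ∀ x ∉ J, φ x = x) (hJ : MapsTo φ J J)
    (hper : J ⊆ closure (J ∩ periodicPts φ)) : Dense (periodicPts (f ∘ φ)) := by
  have hgn : ∀ x ∈ J, (f ∘ φ)^[n] x = φ x := fun x hx => by
    rw [iterate_comp_apply_of_mem hret hout hJ hx hn le_rfl, hid _ (hJ hx)]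
  have hgm : ∀ x ∈ J, ∀ m, (f ∘ φ)^[n * m] x = φ^[m] x := by
    intro x hx m
    induction m with
    | zero => rfl
    | succ m ih =>
      rw [Nat.mul_succ, add_comm, iterate_add_apply, ih, hgn _ (hJ.iterate m hx),
        iterate_succ_apply' φ]
  have hφg : ∀ x ∈ J, x ∈ periodicPts φ → x ∈ periodicPts (f ∘ φ) := by
    rintro x hx ⟨m, hm, hxm⟩
    exact ⟨n * m, Nat.mul_pos hn hm, (hgm x hx m).trans hxm⟩
  have hfg : ∀ z ∈ J, z ∈ periodicPts φ → ∀ j < n, f^[j] z ∈ periodicPts (f ∘ φ) := by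
    intro z hz hzp j hj
    obtain rfl | h0 := Nat.eq_zero_or_pos j
    · exact hφg z hz hzp
    obtain ⟨m, hm, hzm⟩ := hzp
    obtain ⟨m, rfl⟩ := Nat.exists_eq_succ_of_ne_zero hm.ne'
    have hw : φ^[m] z ∈ J := hJ.iterate m hz
    have hφw : φ (φ^[m] z) = z := by rw [← iterate_succ_apply' φ]; exact hzm
    obtain ⟨k, hk, hwk⟩ := hφg _ hw ⟨_, hm, hzm.apply_iterate m⟩
    have := iterate_comp_apply_of_mem hret hout hJ hw h0 hj.le
    rw [hφw] at this
    rw [← this]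
    exact ⟨k, hk, hwk.apply_iterate j⟩
  refine dense_closure.1 (hd.mono ?_)
  rintro x ⟨m, hm, hx⟩
  by_cases hmiss : ∀ i, f^[i] x ∉ J
  · have hgf : ∀ i, (f ∘ φ)^[i] x = f^[i] x := by
      intro i
      induction i with
      | zero => rfl
      | succ i ih =>
        rw [iterate_succ_apply' (f ∘ φ), ih, iterate_succ_apply' f, comp_apply, hout _ (hmiss i)]
    exact subset_closure ⟨m, hm, (hgf m).trans hx⟩
  · push Not at hmiss
    obtain ⟨i, hi⟩ := hmiss
    have hxy : f^[(m * i - i) % n] (f^[i] x) = x := by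
      have hper_y : IsPeriodicPt f n (f^[i] x) := hid _ hi
      rw [hper_y.iterate_mod_apply, ← iterate_add_apply,
        Nat.sub_add_cancel (Nat.le_mul_of_pos_left i hm)]
      exact hx.mul_const i
    rw [← hxy]
    refine closure_mono ?_ (image_closure_subset_closure_image (hf.iterate ((m * i - i) % n))
      (mem_image_of_mem _ (hper hi)))
    rintro _ ⟨z, ⟨hz, hzp⟩, rfl⟩
    exact hfg z hz hzp _ (Nat.mod_lt _ hn)

end LocalPerturbation

section ChebyshevMap

theorem dense_angles_periodic_under_tripling :
    Dense {θ : ℝ | ∃ k > 0, ∃ j : ℤ, 3 ^ k * θ = θ + j * (2 * Real.pi)} := by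
  rw [Metric.dense_iff]
  intro θ ε hε
  have hpi := Real.two_pi_pos
  obtain ⟨k, hk⟩ := pow_unbounded_of_one_lt (1 + 2 * Real.pi / ε) (by norm_num : (1 : ℝ) < 3)
  have hpos : (0 : ℝ) < 3 ^ k - 1 := by
    have : 0 < 2 * Real.pi / ε := by positivity
    linarith
  have hk0 : 0 < k := Nat.pos_of_ne_zero (by rintro rfl; simp at hpos)
  set D : ℝ := 3 ^ k - 1 with hD
  have hDε : 2 * Real.pi < D * ε := by
    rw [← div_lt_iff₀ hε]; linarith
  set j := ⌊θ * D / (2 * Real.pi)⌋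
  have h1 : (j : ℝ) * (2 * Real.pi) ≤ θ * D := by
    rw [← le_div_iff₀ hpi]; exact Int.floor_le _
  have h2 : θ * D < ((j : ℝ) + 1) * (2 * Real.pi) := by
    rw [← div_lt_iff₀ hpi]; exact Int.lt_floor_add_one _
  refine ⟨j * (2 * Real.pi) / D, ?_, k, hk0, j, ?_⟩
  · rw [Metric.mem_ball, Real.dist_eq, abs_lt]
    constructor
    · rw [lt_sub_iff_add_lt, lt_div_iff₀ hpos]; nlinarith
    · rw [sub_lt_iff_lt_add, div_lt_iff₀ hpos]; nlinarith
  · have : (3 : ℝ) ^ k = D + 1 := by rw [hD]; ring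
    rw [this]
    field_simp
    ring

/-- The cubic Chebyshev polynomial on `[-1, 1]`, extended by the identity. -/
noncomputable def cubicFold (t : ℝ) : ℝ :=
  4 * (max (-1) (min 1 t)) ^ 3 - 3 * max (-1) (min 1 t) + (t - max (-1) (min 1 t))

theorem continuous_cubicFold : Continuous cubicFold := by
  unfold cubicFold
  fun_prop

theorem cubicFold_cos (θ : ℝ) : cubicFold (Real.cos θ) = Real.cos (3 * θ) := by
  rw [cubicFold, min_eq_right (Real.cos_le_one θ), max_eq_right (Real.neg_one_le_cos θ),
    Real.cos_three_mul]
  ring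

theorem cubicFold_of_one_lt_abs {t : ℝ} (ht : 1 < |t|) : cubicFold t = t := by
  rw [cubicFold]
  obtain h | h := lt_abs.1 ht
  · rw [min_eq_left h.le, max_eq_right (by norm_num)]; ring
  · rw [min_eq_right (by linarith), max_eq_left (by linarith)]; ring

/-- Near any interior point of the interval there is a map supported on a given closed ball which
has dense periodic points in that ball and crosses the diagonal there. -/
theorem exists_local_fold {p : unitI} {r : ℝ} (hr : 0 < r) (h0 : r ≤ p) (h1 : r ≤ 1 - p) :
    ∃ φ : C(unitI, unitI), (∀ x ∉ closedBall p r, φ x = x) ∧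
      MapsTo φ (closedBall p r) (closedBall p r) ∧
      closedBall p r ⊆ closure (closedBall p r ∩ periodicPts φ) ∧
      ∃ a ∈ closedBall p r, ∃ b ∈ closedBall p r, φ a < a ∧ b < φ b := by
  have hmem : ∀ s : ℝ, |s| ≤ 1 → (p : ℝ) + r * s ∈ Icc (0 : ℝ) 1 := fun s hs => by
    obtain ⟨hs1, hs2⟩ := abs_le.1 hs
    constructor <;> nlinarith
  let h : ℝ → unitI := fun θ => ⟨p + r * Real.cos θ, hmem _ (Real.abs_cos_le_one θ)⟩
  have hh : Continuous h := by
    refine Continuous.subtype_mk ?_ _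
    fun_prop
  have hhJ : ∀ θ, h θ ∈ closedBall p r := fun θ => by
    rw [mem_closedBall, Subtype.dist_eq, Real.dist_eq]
    simp only [h, add_sub_cancel_left, abs_mul, abs_of_pos hr]
    exact mul_le_of_le_one_right hr.le (Real.abs_cos_le_one θ)
  have hsurj : ∀ x ∈ closedBall p r, ∃ θ, h θ = x := fun x hx => by
    rw [mem_closedBall, Subtype.dist_eq, Real.dist_eq] at hx
    have hx' : |((x : ℝ) - p) / r| ≤ 1 := by
      rw [abs_div, abs_of_pos hr]; exact div_le_one_of_le₀ hx hr.le
    refine ⟨Real.arccos (((x : ℝ) - p) / r), Subtype.ext ?_⟩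
    simp only [h]
    rw [Real.cos_arccos (abs_le.1 hx').1 (abs_le.1 hx').2]
    field_simp
    ring
  have hval_h : ∀ θ, (p : ℝ) + r * cubicFold (((h θ : ℝ) - p) / r) = h (3 * θ) := fun θ => by
    simp only [h]
    rw [add_sub_cancel_left, mul_div_cancel_left₀ _ hr.ne', cubicFold_cos]
  have hval_out : ∀ x ∉ closedBall p r, (p : ℝ) + r * cubicFold (((x : ℝ) - p) / r) = x := by
    intro x hx
    rw [mem_closedBall, Subtype.dist_eq, Real.dist_eq, not_le] at hx
    rw [cubicFold_of_one_lt_abs]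
    · field_simp
      ring
    · rw [abs_div, abs_of_pos hr]; exact (one_lt_div hr).2 hx
  have hval_mem : ∀ x : unitI,
      (p : ℝ) + r * cubicFold (((x : ℝ) - p) / r) ∈ Icc (0 : ℝ) 1 := fun x => by
    by_cases hx : x ∈ closedBall p r
    · obtain ⟨θ, rfl⟩ := hsurj x hx
      rw [hval_h]
      exact (h (3 * θ)).2
    · rw [hval_out x hx]
      exact x.2
  let φ : C(unitI, unitI) :=
    ⟨fun x => ⟨p + r * cubicFold (((x : ℝ) - p) / r), hval_mem x⟩, by
      refine Continuous.subtype_mk ?_ _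
      have := continuous_cubicFold
      fun_prop⟩
  have hφh : ∀ θ, φ (h θ) = h (3 * θ) := fun θ => Subtype.ext (hval_h θ)
  have hφiter : ∀ k θ, φ^[k] (h θ) = h (3 ^ k * θ) := by
    intro k θ
    induction k with
    | zero => simp
    | succ k ih => rw [iterate_succ_apply', ih, hφh]; congr 1; ring
  refine ⟨φ, fun x hx => Subtype.ext (hval_out x hx), fun x hx => ?_, fun x hx => ?_,
    h (Real.pi / 3), hhJ _, h (2 * Real.pi / 3), hhJ _, ?_, ?_⟩
  · obtain ⟨θ, rfl⟩ := hsurj x hx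
    rw [hφh]
    exact hhJ _
  · obtain ⟨θ, rfl⟩ := hsurj x hx
    refine closure_mono ?_ (image_closure_subset_closure_image hh
      (mem_image_of_mem h (dense_angles_periodic_under_tripling θ)))
    rintro _ ⟨θ', ⟨k, hk, j, hj⟩, rfl⟩
    refine ⟨hhJ _, k, hk, ?_⟩
    rw [IsPeriodicPt, IsFixedPt, hφiter, hj]
    exact Subtype.ext (by simp only [h, Real.cos_add_int_mul_two_pi])
  · rw [hφh, ← Subtype.coe_lt_coe]
    simp only [h]
    rw [mul_div_cancel₀ _ (by norm_num : (3 : ℝ) ≠ 0), Real.cos_pi, Real.cos_pi_div_three]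
    linarith
  · rw [hφh, ← Subtype.coe_lt_coe]
    simp only [h]
    rw [mul_div_cancel₀ _ (by norm_num : (3 : ℝ) ≠ 0), Real.cos_two_pi,
      show 2 * Real.pi / 3 = Real.pi - Real.pi / 3 by ring, Real.cos_pi_sub,
      Real.cos_pi_div_three]
    linarith

end ChebyshevMap

theorem isOpen_setOf_hasCrossing (U : Set unitI) :
    IsOpen {f : C(unitI, unitI) | HasCrossing f U} := by
  have hcont : ∀ (n : ℕ) (a : unitI), Continuous fun f : C(unitI, unitI) => f^[n] a := by
    intro n a
    induction n with
    | zero => exact continuous_const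
    | succ n ih =>
      simp only [iterate_succ_apply']
      exact continuous_id.eval ih
  rw [isOpen_iff_mem_nhds]
  rintro f ⟨n, a, ha, b, hb, hfa, hfb⟩
  filter_upwards [(isOpen_lt (hcont n a) continuous_const).mem_nhds hfa,
    (isOpen_lt continuous_const (hcont n b)).mem_nhds hfb] with g hga hgb
  exact ⟨n, a, ha, b, hb, hga, hgb⟩

theorem CP_subset_closure_inter_hasCrossing {u v : unitI} (huv : u < v) :
    CP ⊆ closure (CP ∩ {f | HasCrossing f (Ioo u v)}) := by
  intro f hf
  by_cases hcross : HasCrossing f (Ioo u v)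
  · exact subset_closure ⟨hf, hcross⟩
  have hfc : Continuous f := f.continuous
  obtain ⟨n, hn, a, b, hab, hsub, hid, hne⟩ := exists_Ioo_iterate_eq_id_and_ne hfc
    (exists_iterate_eq_id_of_not_hasCrossing hfc hf.2 huv hcross)
  obtain ⟨p, hp⟩ := nonempty_Ioo.2 hab
  rw [Metric.mem_closure_iff]
  intro ε hε
  have hball : ∀ t ∈ 𝓝 p, ∀ᶠ δ in 𝓝[>] (0 : ℝ), closedBall p δ ⊆ t := fun t ht =>
    nhdsWithin_le_nhds ((tendsto_closedBall_smallSets p).eventually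
      (eventually_smallSets_subset.2 ht))
  have hsep : ∀ᶠ δ in 𝓝[>] (0 : ℝ), ∀ x ∈ closedBall p δ, ∀ y ∈ closedBall p δ,
      ∀ i ∈ Finset.Ioo 0 n, f^[i] x ≠ y := by
    have hprod : ∀ᶠ z in 𝓝 p ×ˢ 𝓝 p, ∀ i ∈ Finset.Ioo 0 n, f^[i] z.1 ≠ z.2 := by
      rw [← nhds_prod_eq, Filter.eventually_all_finset]
      intro i hi
      rw [Finset.mem_Ioo] at hi
      exact (isOpen_ne_fun ((hfc.iterate i).comp continuous_fst) continuous_snd).mem_nhds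
        (hne p hp i hi.1 hi.2)
    obtain ⟨t, ht, hti⟩ := eventually_prod_self_iff'.1 hprod
    filter_upwards [hball t ht] with δ hδ x hx y hy using
      hti x (hδ hx) y (hδ hy)
  have hsmall : ∀ᶠ δ in 𝓝[>] (0 : ℝ), closedBall p δ ⊆ Ioo a b ∩ f ⁻¹' ball (f p) (ε / 2) :=
    hball _ (inter_mem (isOpen_Ioo.mem_nhds hp)
      (hfc.continuousAt.preimage_mem_nhds (ball_mem_nhds _ (half_pos hε))))
  have hp0 : (0 : ℝ) < p := lt_of_le_of_lt a.2.1 hp.1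
  have hp1 : (p : ℝ) < 1 := lt_of_lt_of_le hp.2 b.2.2
  have hr0 : ∀ᶠ δ in 𝓝[>] (0 : ℝ), δ ∈ Ioo 0 (min (p : ℝ) (1 - p)) :=
    Ioo_mem_nhdsGT (lt_min hp0 (by linarith))
  obtain ⟨r, hsep, hsmall, hr, hrmin⟩ := (hsep.and (hsmall.and hr0)).exists
  obtain ⟨φ, hout, hJ, hper, c, hc, d, hd, hφc, hφd⟩ := exists_local_fold hr
    (hrmin.le.trans (min_le_left _ _)) (hrmin.le.trans (min_le_right _ _))
  have hidJ : ∀ x ∈ closedBall p r, f^[n] x = x := fun x hx => hid x (hsmall hx).1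
  have hret : ∀ x ∈ closedBall p r, ∀ i, 0 < i → i < n → f^[i] x ∉ closedBall p r :=
    fun x hx i h0 hi hmem => hsep x hx _ hmem i (Finset.mem_Ioo.2 ⟨h0, hi⟩) rfl
  have hdense := dense_periodicPts_comp hfc hf.2 hn hidJ hret hout hJ hper
  have hgn : ∀ x ∈ closedBall p r, (f ∘ φ)^[n] x = φ x := fun x hx => by
    rw [iterate_comp_apply_of_mem hret hout hJ hx hn le_rfl, hidJ _ (hJ hx)]
  refine ⟨f.comp φ, ⟨⟨surjective_of_dense_periodicPts (f.comp φ).continuous hdense, hdense⟩,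
    n, c, hsub (hsmall hc).1, d, hsub (hsmall hd).1, ?_, ?_⟩, ?_⟩
  · rw [ContinuousMap.coe_comp, hgn c hc]
    exact hφc
  · rw [ContinuousMap.coe_comp, hgn d hd]
    exact hφd
  · rw [ContinuousMap.dist_lt_iff hε]
    intro x
    rw [ContinuousMap.comp_apply]
    by_cases hx : x ∈ closedBall p r
    · have h1 := mem_ball.1 (hsmall hx).2
      have h2 := mem_ball'.1 (hsmall (hJ hx)).2
      have := dist_triangle (f x) (f p) (f (φ x))
      linarith
    · rw [hout x hx, dist_self]
      exact hε

/-- `CP` is a residual subset of `cl(CP)`: there is a dense `Gδ` subset of the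
space `cl(CP)` (with the uniform metric) contained in `CP`. -/
theorem CP_residual_in_closure :
    ∃ S : Set (closure CP : Set C(unitI, unitI)),
      IsGδ S ∧ Dense S ∧ ∀ f ∈ S, (f : C(unitI, unitI)) ∈ CP := by
  have : CompleteSpace (closure CP : Set C(unitI, unitI)) := isClosed_closure.completeSpace_coe
  obtain ⟨D, hDc, hDd⟩ := TopologicalSpace.exists_countable_dense unitI
  let T : Set (unitI × unitI) := {w | w ∈ D ×ˢ D ∧ w.1 < w.2}
  have hT : T.Countable := (hDc.prod hDc).mono fun w hw => hw.1
  let O : unitI × unitI → Set (closure CP : Set C(unitI, unitI)) :=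
    fun w => Subtype.val ⁻¹' {f | HasCrossing f (Ioo w.1 w.2)}
  have hO : ∀ w, IsOpen (O w) := fun w =>
    (isOpen_setOf_hasCrossing _).preimage continuous_subtype_val
  refine ⟨⋂ w ∈ T, O w, IsGδ.biInter hT fun w _ => (hO w).isGδ,
    dense_biInter_of_isOpen (fun w _ => hO w) hT fun w hw => ?_, fun f hf => ?_⟩
  · rw [Subtype.dense_iff]
    refine closure_minimal ((CP_subset_closure_inter_hasCrossing hw.2).trans
      (closure_mono ?_)) isClosed_closure
    exact fun g hg => ⟨⟨g, subset_closure hg.1⟩, hg.2, rfl⟩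
  · have hd : Dense (periodicPts (f : C(unitI, unitI))) := by
      refine dense_iff_inter_open.2 fun W hW hne => ?_
      obtain ⟨a, b, hab, hsub⟩ := hW.exists_Ioo_subset hne
      obtain ⟨c, hcD, hac, hcb⟩ := hDd.exists_between hab
      obtain ⟨d, hdD, hcd, hdb⟩ := hDd.exists_between hcb
      have hcross : HasCrossing (f : C(unitI, unitI)) (Ioo c d) :=
        mem_iInter₂.1 hf (c, d) ⟨⟨hcD, hdD⟩, hcd⟩
      obtain ⟨x, hx, hxp⟩ := hcross.exists_periodicPt (map_continuous _) isPreconnected_Ioo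
      exact ⟨x, hsub ⟨hac.trans hx.1, hx.2.trans hdb⟩, hxp⟩
    exact ⟨surjective_of_dense_periodicPts (map_continuous _) hd, hd⟩
end

section
/- The set cl(CP) \ CP is dense in cl(CP). -/
open Set Function Metric

/-- A map is chain transitive if it has no proper attractor block. -/
def ChainTransitive (f : C(unitI, unitI)) : Prop :=
  ∀ E : Set unitI, IsClosed E → E.Nonempty → MapsTo f E (interior E) → E = univ

theorem chainTransitive_of_mem_CP {f : C(unitI, unitI)} (hf : f ∈ CP) : ChainTransitive f := by
  intro E hE hne hmaps
  have hopen : IsOpen (f ⁻¹' interior E) := isOpen_interior.preimage f.continuous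
  have heq : f ⁻¹' interior E = E := by
    refine Subset.antisymm ?_ hmaps
    by_contra hsub
    obtain ⟨x, hx, hxE⟩ := not_subset.mp hsub
    obtain ⟨p, ⟨hp, hpE⟩, n, hn, hper⟩ :=
      hf.2.inter_open_nonempty _ (hopen.inter hE.isOpen_compl) ⟨x, hx, hxE⟩
    have hEE : MapsTo f E E := fun y hy => interior_subset (hmaps hy)
    apply hpE
    obtain ⟨m, rfl⟩ := Nat.exists_eq_succ_of_ne_zero hn.ne'
    have h := hEE.iterate m (interior_subset hp)
    rwa [← iterate_succ_apply, hper.eq] at h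
  have hclopen : IsClopen E := ⟨hE, heq ▸ hopen⟩
  exact (isClopen_iff.mp hclopen).resolve_left hne.ne_empty

theorem exists_uIcc_subset {U : Set unitI} (hU : IsOpen U) {x : unitI} (hx : x ∈ U) :
    ∃ b, b ≠ x ∧ uIcc x b ⊆ U := by
  obtain ⟨r, hr, hball⟩ := Metric.isOpen_iff.mp hU x hx
  have hmem : ball x r ∈ nhdsWithin x {x}ᶜ := mem_nhdsWithin_of_mem_nhds (ball_mem_nhds x hr)
  obtain ⟨b, hb, hbx⟩ :=
    Filter.nonempty_of_mem (Filter.inter_mem hmem self_mem_nhdsWithin)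
  refine ⟨b, hbx, fun y hy => hball ?_⟩
  rw [mem_ball, Subtype.dist_eq, Real.dist_eq] at hb ⊢
  rcases le_total x b with h | h
  · rw [uIcc_of_le h, mem_Icc, ← Subtype.coe_le_coe, ← Subtype.coe_le_coe] at hy
    rw [abs_lt] at hb ⊢
    constructor <;> linarith
  · rw [uIcc_of_ge h, mem_Icc, ← Subtype.coe_le_coe, ← Subtype.coe_le_coe] at hy
    rw [abs_lt] at hb ⊢
    constructor <;> linarith

theorem isPreconnected_iterate_image (g : C(unitI, unitI)) {K : Set unitI}
    (hK : IsPreconnected K) (n : ℕ) : IsPreconnected (g^[n] '' K) :=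
  hK.image _ (g.continuous.iterate n).continuousOn

theorem iterate_succ_image {α : Type*} (g : α → α) (n : ℕ) (K : Set α) :
    g^[n + 1] '' K = g '' (g^[n] '' K) := by
  rw [iterate_succ', image_comp]

/-- The `i`-th interval of the partition of `[0,1]` into `N` equal parts. -/
def block (N i : ℕ) : Set unitI := {x | (i : ℝ) ≤ N * x ∧ (N : ℝ) * x ≤ i + 1}

theorem isClosed_block (N i : ℕ) : IsClosed (block N i) := by
  have h1 : IsClosed {x : unitI | (i : ℝ) ≤ N * x} := isClosed_le (by fun_prop) (by fun_prop)
  have h2 : IsClosed {x : unitI | (N : ℝ) * x ≤ i + 1} := isClosed_le (by fun_prop) (by fun_prop)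
  exact h1.inter h2

theorem isPreconnected_block (N i : ℕ) : IsPreconnected (block N i) := by
  refine OrdConnected.isPreconnected ⟨fun x hx y hy z hz => ?_⟩
  have h1 : (x : ℝ) ≤ z := hz.1
  have h2 : (z : ℝ) ≤ y := hz.2
  have hN : (0 : ℝ) ≤ N := N.cast_nonneg
  exact ⟨hx.1.trans (by gcongr), le_trans (by gcongr) hy.2⟩

theorem exists_mem_block {N : ℕ} (hN : 0 < N) (x : unitI) : ∃ i < N, x ∈ block N i := by
  have hN' : (0 : ℝ) < N := Nat.cast_pos.mpr hN
  have h0 : (0 : ℝ) ≤ N * x := mul_nonneg hN'.le x.2.1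
  rcases x.2.2.lt_or_eq with h | h
  · exact ⟨⌊(N : ℝ) * x⌋₊, (Nat.floor_lt h0).mpr (by nlinarith), Nat.floor_le h0,
      (Nat.lt_floor_add_one _).le⟩
  · refine ⟨N - 1, by omega, ?_⟩
    simp only [block, mem_ofPred_eq, h, Nat.cast_sub (Nat.succ_le_of_lt hN)]
    constructor <;> norm_num

theorem exists_grid_point {N j : ℕ} (hN : 0 < N) (hj : j ≤ 8 * N) :
    ∃ y : unitI, 8 * (N : ℝ) * y = j := by
  have hN' : (0 : ℝ) < N := Nat.cast_pos.mpr hN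
  have hj' : (j : ℝ) ≤ 8 * N := by exact_mod_cast hj
  exact ⟨⟨j / (8 * N), by positivity, by rw [div_le_one (by positivity)]; exact hj'⟩, by
    field_simp⟩

theorem block_subset_of_isPreconnected {N k : ℕ} (hN : 0 < N) {K : Set unitI}
    (hK : IsPreconnected K) {a b : unitI} (ha : a ∈ K) (hb : b ∈ K) (hak : (N : ℝ) * a ≤ k)
    (hbk : (k : ℝ) + 1 ≤ N * b) : block N k ⊆ K := by
  have hN' : (0 : ℝ) < N := Nat.cast_pos.mpr hN
  intro x hx
  exact hK.Icc_subset ha hb ⟨Subtype.coe_le_coe.mp (le_of_mul_le_mul_left (hak.trans hx.1) hN'),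
    Subtype.coe_le_coe.mp (le_of_mul_le_mul_left (hx.2.trans hbk) hN')⟩

/-- The map `g` is the piecewise linear interpolation of the values `v j / N` at the points
`j / (8 * N)`. -/
def IsInterpolation (N : ℕ) (v : ℕ → ℕ) (g : C(unitI, unitI)) : Prop :=
  ∀ j < 8 * N, ∀ x : unitI, (j : ℝ) ≤ 8 * N * x → 8 * (N : ℝ) * x ≤ j + 1 →
    (N : ℝ) * g x = v j + ((v (j + 1) : ℝ) - v j) * (8 * N * x - j)

theorem sum_mul_clamp (w : ℕ → ℝ) {s : ℝ} {j n : ℕ} (hj : j < n) (h1 : (j : ℝ) ≤ s)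
    (h2 : s ≤ j + 1) :
    w 0 + ∑ i ∈ Finset.range n, (w (i + 1) - w i) * max 0 (min 1 (s - i)) =
      w j + (w (j + 1) - w j) * (s - j) := by
  induction n, Nat.succ_le_of_lt hj using Nat.le_induction with
  | base =>
    rw [Finset.sum_range_succ, ← add_assoc]
    have hsum : ∑ i ∈ Finset.range j, (w (i + 1) - w i) * max 0 (min 1 (s - i)) =
        ∑ i ∈ Finset.range j, (w (i + 1) - w i) := by
      refine Finset.sum_congr rfl fun i hi => ?_
      have hi' : (i : ℝ) + 1 ≤ j := by exact_mod_cast Finset.mem_range.mp hi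
      rw [min_eq_left (by linarith), max_eq_right zero_le_one, mul_one]
    rw [hsum, Finset.sum_range_sub, min_eq_right (by linarith), max_eq_right (by linarith)]
    ring
  | succ m hm ih =>
    have hm' : (j : ℝ) + 1 ≤ m := by exact_mod_cast hm
    rw [Finset.sum_range_succ, ← add_assoc, ih hm,
      max_eq_left ((min_le_right _ _).trans (by linarith)), mul_zero, add_zero]

theorem exists_cell {N : ℕ} (hN : 0 < N) (x : unitI) :
    ∃ j < 8 * N, (j : ℝ) ≤ 8 * N * x ∧ 8 * (N : ℝ) * x ≤ j + 1 := by
  obtain ⟨j, hj, h⟩ := exists_mem_block (N := 8 * N) (by omega) x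
  refine ⟨j, hj, ?_⟩
  simpa [block] using h

theorem exists_isInterpolation {N : ℕ} (hN : 0 < N) {v : ℕ → ℕ} (hv : ∀ j ≤ 8 * N, v j ≤ N) :
    ∃ g, IsInterpolation N v g := by
  have hN' : (0 : ℝ) < N := Nat.cast_pos.mpr hN
  let G : unitI → ℝ := fun x => ((v 0 : ℝ) + ∑ i ∈ Finset.range (8 * N),
    ((v (i + 1) : ℝ) - v i) * max 0 (min 1 (8 * (N : ℝ) * x - i))) / N
  have hG : ∀ j < 8 * N, ∀ x : unitI, (j : ℝ) ≤ 8 * N * x → 8 * (N : ℝ) * x ≤ j + 1 →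
      N * G x = v j + ((v (j + 1) : ℝ) - v j) * (8 * N * x - j) := by
    intro j hj x h1 h2
    rw [← sum_mul_clamp (fun i => (v i : ℝ)) hj h1 h2]
    exact mul_div_cancel₀ _ hN'.ne'
  have hmem : ∀ x, G x ∈ Icc (0 : ℝ) 1 := by
    intro x
    obtain ⟨j, hj, h1, h2⟩ := exists_cell hN x
    have h := hG j hj x h1 h2
    have hv1 : (v j : ℝ) ≤ N := by exact_mod_cast hv j hj.le
    have hv2 : (v (j + 1) : ℝ) ≤ N := by exact_mod_cast hv (j + 1) hj
    have hv3 : (0 : ℝ) ≤ v j := Nat.cast_nonneg _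
    have hv4 : (0 : ℝ) ≤ v (j + 1) := Nat.cast_nonneg _
    constructor
    · refine nonneg_of_mul_nonneg_right ?_ hN'
      rw [h]
      nlinarith
    · refine le_of_mul_le_mul_left ?_ hN'
      rw [h]
      nlinarith
  have hcont : Continuous G := by
    refine Continuous.div_const (continuous_const.add
      (continuous_finsetSum _ fun i _ => ?_)) _
    fun_prop
  exact ⟨⟨fun x => ⟨G x, hmem x⟩, hcont.subtype_mk _⟩, hG⟩

namespace IsInterpolation

variable {N : ℕ} {v : ℕ → ℕ} {g : C(unitI, unitI)}

theorem apply_grid (hg : IsInterpolation N v g) {j : ℕ} (hN : 0 < N) (hj : j ≤ 8 * N)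
    {y : unitI} (hy : 8 * (N : ℝ) * y = j) : (N : ℝ) * g y = v j := by
  rcases hj.lt_or_eq with h | h
  · rw [hg j h y hy.ge (by linarith), hy]
    ring
  · obtain ⟨i, rfl⟩ : ∃ i, j = i + 1 := ⟨j - 1, by omega⟩
    push_cast at hy
    rw [hg i (by omega) y (by linarith) hy.le, hy]
    ring

theorem expands (hg : IsInterpolation N v g) {j : ℕ} (hN : 0 < N) (hj : j < 8 * N)
    (hv : v j ≠ v (j + 1)) {p q : unitI} (hp1 : (j : ℝ) ≤ 8 * N * p)
    (hp2 : 8 * (N : ℝ) * p ≤ j + 1) (hq1 : (j : ℝ) ≤ 8 * N * q)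
    (hq2 : 8 * (N : ℝ) * q ≤ j + 1) : 8 * |(q : ℝ) - p| ≤ |(g q : ℝ) - g p| := by
  have hN' : (0 : ℝ) < N := Nat.cast_pos.mpr hN
  have hslope : (1 : ℝ) ≤ |(v (j + 1) : ℝ) - v j| := by
    have h : (1 : ℤ) ≤ |(v (j + 1) : ℤ) - v j| := Int.one_le_abs (by omega)
    exact_mod_cast h
  have heq : (g q : ℝ) - g p = ((v (j + 1) : ℝ) - v j) * (8 * (q - p)) := by
    apply mul_left_cancel₀ hN'.ne'
    rw [mul_sub, hg j hj q hq1 hq2, hg j hj p hp1 hp2]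
    ring
  rw [heq, abs_mul, abs_mul, abs_of_pos (by norm_num : (0 : ℝ) < 8)]
  exact le_mul_of_one_le_left (by positivity) hslope

/-- The forward orbit of a nondegenerate connected set meets the multiples of `1 / N`. -/
theorem exists_mesh_mem_iterate (hg : IsInterpolation N v g) (hN : 0 < N) {K : Set unitI}
    (hK : IsPreconnected K) (hnt : K.Nontrivial) :
    ∃ n, ∃ m ∈ g^[n] '' K, ∃ k : ℕ, (N : ℝ) * m = k := by
  by_contra! hno
  obtain ⟨a, ha, b, hb, hab⟩ := hnt.exists_lt
  have hab' : (0 : ℝ) < b - a := sub_pos.mpr hab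
  have grow : ∀ n : ℕ, ∃ p ∈ g^[n] '' K, ∃ q ∈ g^[n] '' K,
      8 ^ n * ((b : ℝ) - a) ≤ q - p := by
    intro n
    induction n with
    | zero => exact ⟨a, by simpa using ha, b, by simpa using hb, by simp⟩
    | succ n ih =>
      obtain ⟨p, hp, q, hq, hpq⟩ := ih
      have hpq0 : (0 : ℝ) < q - p := lt_of_lt_of_le (by positivity) hpq
      obtain ⟨j, hj, h1, h2⟩ := exists_cell hN p
      have hq2 : 8 * (N : ℝ) * q ≤ j + 1 := by
        by_contra! hlt
        obtain ⟨y, hy⟩ := exists_grid_point (j := j + 1) hN hj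
        push_cast at hy
        have hN' : (0 : ℝ) < 8 * N := by positivity
        have hyK : y ∈ g^[n] '' K := (isPreconnected_iterate_image g hK n).Icc_subset hp hq
          ⟨Subtype.coe_le_coe.mp (le_of_mul_le_mul_left (h2.trans hy.ge) hN'),
            Subtype.coe_le_coe.mp (le_of_mul_le_mul_left (hy.le.trans hlt.le) hN')⟩
        refine hno (n + 1) (g y) ?_ _ (hg.apply_grid hN hj (by push_cast; exact hy))
        rw [iterate_succ_image]
        exact mem_image_of_mem _ hyK
      have hv : v j ≠ v (j + 1) := by
        intro hv
        refine hno (n + 1) (g p) ?_ (v j) ?_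
        · rw [iterate_succ_image]
          exact mem_image_of_mem _ hp
        · rw [hg j hj p h1 h2, ← hv]
          ring
      have hpq' : (p : ℝ) ≤ q := by linarith
      have hexp := hg.expands hN hj hv h1 h2 (h1.trans (by gcongr)) hq2
      rw [abs_of_pos hpq0] at hexp
      have hlen : 8 ^ (n + 1) * ((b : ℝ) - a) ≤ |(g q : ℝ) - g p| := by
        rw [pow_succ]
        linarith
      rw [iterate_succ_image]
      rcases abs_cases ((g q : ℝ) - g p) with h | h
      · exact ⟨g p, mem_image_of_mem _ hp, g q, mem_image_of_mem _ hq, by linarith⟩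
      · exact ⟨g q, mem_image_of_mem _ hq, g p, mem_image_of_mem _ hp, by linarith⟩
  obtain ⟨n, hn⟩ := pow_unbounded_of_one_lt (1 / ((b : ℝ) - a)) (by norm_num : (1 : ℝ) < 8)
  obtain ⟨p, -, q, -, hpq⟩ := grow n
  rw [div_lt_iff₀ hab'] at hn
  linarith [p.2.1, q.2.2]

theorem block_subset_image_cell (hg : IsInterpolation N v g) (hN : 0 < N) {j : ℕ}
    (hj : j < 8 * N) (hvN : ∀ j ≤ 8 * N, v j ≤ N) (hv : v j ≠ v (j + 1)) {K : Set unitI}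
    (hK : IsPreconnected K) {y z : unitI} (hyK : y ∈ K) (hzK : z ∈ K)
    (hy : 8 * (N : ℝ) * y = j) (hz : 8 * (N : ℝ) * z = (j + 1 : ℕ)) :
    ∃ i < N, block N i ⊆ g '' K := by
  have hgy := hg.apply_grid hN hj.le hy
  have hgz := hg.apply_grid hN hj hz
  have hKi := hK.image g g.continuous.continuousOn
  have hvj := hvN j hj.le
  have hvj' := hvN (j + 1) hj
  rcases hv.lt_or_gt with h | h
  · exact ⟨v j, by omega, block_subset_of_isPreconnected hN hKi (mem_image_of_mem _ hyK)
      (mem_image_of_mem _ hzK) hgy.le (hgz ▸ by exact_mod_cast h)⟩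
  · exact ⟨v (j + 1), by omega, block_subset_of_isPreconnected hN hKi (mem_image_of_mem _ hzK)
      (mem_image_of_mem _ hyK) hgz.le (hgy ▸ by exact_mod_cast h)⟩

/-- A nondegenerate connected set containing a multiple of `1 / N` eventually covers a block,
provided that `g` is not constant next to the multiples of `1 / N`. -/
theorem exists_block_subset_iterate (hg : IsInterpolation N v g) (hN : 0 < N)
    (hvN : ∀ j ≤ 8 * N, v j ≤ N) (hright : ∀ k, v (8 * k) ≠ v (8 * k + 1))
    (hleft : ∀ k, v (8 * k + 7) ≠ v (8 * k + 8)) {K : Set unitI} (hK : IsPreconnected K)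
    {m b : unitI} (hm : m ∈ K) (hb : b ∈ K) (hbm : b ≠ m) {k : ℕ} (hk : (N : ℝ) * m = k) :
    ∃ n > 0, ∃ i < N, block N i ⊆ g^[n] '' K := by
  by_contra! hno
  have hbm' : (0 : ℝ) < |(b : ℝ) - m| := abs_pos.mpr (sub_ne_zero.mpr (Subtype.coe_ne_coe.mpr hbm))
  have hN8 : (0 : ℝ) < 8 * N := by positivity
  have grow : ∀ n : ℕ, ∃ p ∈ g^[n] '' K, ∃ q ∈ g^[n] '' K,
      (∃ l : ℕ, (N : ℝ) * p = l) ∧ 8 ^ n * |(b : ℝ) - m| ≤ |(q : ℝ) - p| := by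
    intro n
    induction n with
    | zero => exact ⟨m, by simpa using hm, b, by simpa using hb, ⟨k, hk⟩, by simp⟩
    | succ n ih =>
      obtain ⟨p, hp, q, hq, ⟨l, hl⟩, hpq⟩ := ih
      have hK' := isPreconnected_iterate_image g hK n
      have hpq0 : (0 : ℝ) < |(q : ℝ) - p| := lt_of_lt_of_le (by positivity) hpq
      have hlN : l ≤ N := by
        have : (l : ℝ) ≤ N := hl ▸ mul_le_of_le_one_right (Nat.cast_nonneg _) p.2.2
        exact_mod_cast this
      have hp8 : 8 * (N : ℝ) * p = (8 * l : ℕ) := by push_cast; linarith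
      have hno' : ∀ i < N, ¬ block N i ⊆ g '' (g^[n] '' K) := by
        intro i hi
        rw [← iterate_succ_image]
        exact hno (n + 1) n.succ_pos i hi
      have hexp : 8 * |(q : ℝ) - p| ≤ |(g q : ℝ) - g p| := by
        rcases lt_or_gt_of_ne (sub_ne_zero.mp (abs_pos.mp hpq0)) with hlt | hlt
        · have hl0 : l ≠ 0 := by
            rintro rfl
            have : (p : ℝ) = 0 := by
              simpa [hN.ne'] using hl
            linarith [q.2.1]
          obtain ⟨t, rfl⟩ := Nat.exists_eq_succ_of_ne_zero hl0
          have hj : 8 * t + 7 < 8 * N := by omega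
          push_cast at hp8
          have hq1 : ((8 * t + 7 : ℕ) : ℝ) ≤ 8 * N * q := by
            by_contra! hcon
            obtain ⟨y, hy⟩ := exists_grid_point hN hj.le
            have hyK : y ∈ g^[n] '' K := hK'.Icc_subset hq hp
              ⟨Subtype.coe_le_coe.mp (le_of_mul_le_mul_left (by linarith) hN8),
                Subtype.coe_le_coe.mp (le_of_mul_le_mul_left
                  (by rw [hy, hp8]; push_cast; linarith) hN8)⟩
            obtain ⟨i, hi, hsub⟩ := hg.block_subset_image_cell hN hj hvN (hleft t) hK' hyK hp hy
              (by rw [hp8]; push_cast; ring)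
            exact hno' i hi hsub
          refine hg.expands hN hj (hleft t) ?_ ?_ hq1 ?_
          · rw [hp8]; push_cast; linarith
          · rw [hp8]; push_cast; linarith
          · refine le_trans (mul_le_mul_of_nonneg_left hlt.le hN8.le) ?_
            rw [hp8]; push_cast; linarith
        · have hlN' : l < N := by
            refine hlN.lt_of_ne ?_
            rintro rfl
            have : (p : ℝ) = 1 := by
              simpa [hN.ne'] using hl
            linarith [q.2.2]
          have hj : 8 * l < 8 * N := by omega
          have hq2 : 8 * (N : ℝ) * q ≤ (8 * l : ℕ) + 1 := by
            by_contra! hcon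
            obtain ⟨y, hy⟩ := exists_grid_point (j := 8 * l + 1) hN hj
            have hyK : y ∈ g^[n] '' K := hK'.Icc_subset hp hq
              ⟨Subtype.coe_le_coe.mp (le_of_mul_le_mul_left
                  (by rw [hy, hp8]; push_cast; linarith) hN8),
                Subtype.coe_le_coe.mp (le_of_mul_le_mul_left
                  (by rw [hy]; push_cast at hcon ⊢; linarith) hN8)⟩
            obtain ⟨i, hi, hsub⟩ := hg.block_subset_image_cell hN hj hvN (hright l) hK' hp hyK
              hp8 hy
            exact hno' i hi hsub
          refine hg.expands hN hj (hright l) hp8.ge (by linarith) ?_ hq2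
          rw [← hp8]
          exact mul_le_mul_of_nonneg_left hlt.le hN8.le
      rw [iterate_succ_image]
      refine ⟨g p, mem_image_of_mem _ hp, g q, mem_image_of_mem _ hq,
        ⟨_, hg.apply_grid hN (by omega) hp8⟩, ?_⟩
      rw [pow_succ]
      linarith
  obtain ⟨n, hn⟩ := pow_unbounded_of_one_lt (1 / |(b : ℝ) - m|) (by norm_num : (1 : ℝ) < 8)
  obtain ⟨p, -, q, -, -, hpq⟩ := grow n
  rw [div_lt_iff₀ hbm'] at hn
  have hle : |(q : ℝ) - p| ≤ 1 := abs_le.mpr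
    ⟨by linarith [p.2.2, q.2.1], by linarith [p.2.1, q.2.2]⟩
  linarith

theorem nontrivial_image (hg : IsInterpolation N v g) (hN : 0 < N)
    (hv : ∀ j, v j ≠ v (j + 1)) {K : Set unitI} (hK : IsPreconnected K) (hnt : K.Nontrivial) :
    (g '' K).Nontrivial := by
  obtain ⟨a, ha, b, hb, hab⟩ := hnt.exists_lt
  have hab' : (a : ℝ) < b := hab
  have hN8 : (0 : ℝ) < 8 * N := by positivity
  have key : ∃ j < 8 * N, (j : ℝ) ≤ 8 * N * a ∧ 8 * (N : ℝ) * a < j + 1 := by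
    have h0 : (0 : ℝ) ≤ 8 * N * a := mul_nonneg hN8.le a.2.1
    refine ⟨⌊8 * (N : ℝ) * a⌋₊, (Nat.floor_lt h0).mpr ?_, Nat.floor_le h0,
      Nat.lt_floor_add_one _⟩
    push_cast
    exact mul_lt_of_lt_one_right hN8 (hab'.trans_le b.2.2)
  obtain ⟨j, hj, h1, h2⟩ := key
  obtain ⟨c, hcK, hac, hc⟩ : ∃ c ∈ K, (a : ℝ) < c ∧ 8 * (N : ℝ) * c ≤ j + 1 := by
    rcases le_total (8 * (N : ℝ) * b) (j + 1) with h | h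
    · exact ⟨b, hb, hab, h⟩
    · obtain ⟨y, hy⟩ := exists_grid_point (j := j + 1) hN hj
      push_cast at hy
      have hay : (a : ℝ) < y := lt_of_mul_lt_mul_left (h2.trans_eq hy.symm) hN8.le
      exact ⟨y, hK.Icc_subset ha hb ⟨hay.le, Subtype.coe_le_coe.mp
        (le_of_mul_le_mul_left (hy.le.trans h) hN8)⟩, hay, hy.le⟩
  refine ⟨g a, mem_image_of_mem _ ha, g c, mem_image_of_mem _ hcK, fun heq => ?_⟩
  have h := hg.expands hN hj (hv j) h1 h2.le (h1.trans (by gcongr)) hc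
  rw [heq, sub_self, abs_zero, abs_of_pos (sub_pos.mpr hac)] at h
  linarith

theorem nontrivial_iterate_image (hg : IsInterpolation N v g) (hN : 0 < N)
    (hv : ∀ j, v j ≠ v (j + 1)) {K : Set unitI} (hK : IsPreconnected K) (hnt : K.Nontrivial)
    (n : ℕ) : (g^[n] '' K).Nontrivial := by
  induction n with
  | zero => simpa using hnt
  | succ n ih =>
    rw [iterate_succ_image]
    exact hg.nontrivial_image hN hv (isPreconnected_iterate_image g hK n) ih

end IsInterpolation

/-- The image under `g` of every block covers all the blocks met by its image under `f`. -/
def Dominates (N : ℕ) (g f : C(unitI, unitI)) : Prop :=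
  ∀ i < N, ∀ k < N, ∀ x ∈ block N i, f x ∈ block N k → block N k ⊆ g '' block N i

theorem Dominates.iterate_covers {N : ℕ} {f g : C(unitI, unitI)} (hdom : Dominates N g f)
    (hN : 0 < N) (hf : ChainTransitive f) {K : Set unitI} {n i : ℕ} (hn : 0 < n) (hi : i < N)
    (hsub : block N i ⊆ g^[n] '' K) (x : unitI) :
    ∃ n > 0, ∃ j < N, x ∈ block N j ∧ block N j ⊆ g^[n] '' K := by
  let S : Set ℕ := {j | j < N ∧ ∃ n > 0, block N j ⊆ g^[n] '' K}
  have hfin : S.Finite := (finite_lt_nat N).subset fun j hj => hj.1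
  have hfin' : {j | j < N ∧ j ∉ S}.Finite := (finite_lt_nat N).subset fun j hj => hj.1
  have huniv : (⋃ j ∈ S, block N j) = univ := by
    apply hf
    · exact hfin.isClosed_biUnion fun j _ => isClosed_block N j
    · have hiS : i ∈ S := ⟨hi, n, hn, hsub⟩
      obtain ⟨y, hy⟩ := exists_grid_point (j := 8 * i) hN (by omega)
      push_cast at hy
      exact ⟨y, mem_biUnion hiS ⟨by linarith, by linarith⟩⟩
    · intro y hy
      obtain ⟨j, hj, hyj⟩ := mem_iUnion₂.mp hy
      obtain ⟨hjN, l, hl, hjl⟩ := hj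
      refine mem_interior.mpr ⟨(⋃ k ∈ {k | k < N ∧ k ∉ S}, block N k)ᶜ, ?_, ?_, ?_⟩
      · intro z hz
        obtain ⟨k, hk, hzk⟩ := exists_mem_block hN z
        by_cases hkS : k ∈ S
        · exact mem_biUnion hkS hzk
        · exact absurd (mem_biUnion (show k ∈ {k | k < N ∧ k ∉ S} from ⟨hk, hkS⟩) hzk) hz
      · exact (hfin'.isClosed_biUnion fun k _ => isClosed_block N k).isOpen_compl
      · intro hmem
        obtain ⟨k, ⟨hk, hkS⟩, hyk⟩ := mem_iUnion₂.mp hmem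
        refine hkS ⟨hk, l + 1, l.succ_pos, ?_⟩
        rw [iterate_succ_image]
        exact (hdom j hjN k hk y hyj hyk).trans (image_mono hjl)
  obtain ⟨j, ⟨hjN, hj⟩, hxj⟩ := mem_iUnion₂.mp (huniv.ge (mem_univ x))
  obtain ⟨l, hl, hjl⟩ := hj
  exact ⟨l, hl, j, hjN, hxj, hjl⟩

theorem IsInterpolation.mem_CP {N : ℕ} {v : ℕ → ℕ} {f g : C(unitI, unitI)}
    (hg : IsInterpolation N v g) (hN : 0 < N) (hvN : ∀ j ≤ 8 * N, v j ≤ N)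
    (hv : ∀ j, v j ≠ v (j + 1)) (hdom : Dominates N g f) (hf : ChainTransitive f) : g ∈ CP := by
  have covers : ∀ K : Set unitI, IsPreconnected K → K.Nontrivial → ∀ x : unitI,
      ∃ n > 0, ∃ j < N, x ∈ block N j ∧ block N j ⊆ g^[n] '' K := by
    intro K hK hnt x
    obtain ⟨n, m, hm, k, hk⟩ := hg.exists_mesh_mem_iterate hN hK hnt
    obtain ⟨b, hb, hbm⟩ := (hg.nontrivial_iterate_image hN hv hK hnt n).exists_ne m
    obtain ⟨l, hl, i, hi, hsub⟩ := hg.exists_block_subset_iterate hN hvN (fun k => hv (8 * k))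
      (fun k => hv (8 * k + 7)) (isPreconnected_iterate_image g hK n) hm hb hbm hk
    rw [← image_comp, ← iterate_add] at hsub
    exact hdom.iterate_covers hN hf (by omega) hi hsub x
  constructor
  · intro x
    obtain ⟨n, hn, j, -, hx, hsub⟩ := covers univ isPreconnected_univ nontrivial_univ x
    obtain ⟨l, rfl⟩ := Nat.exists_eq_succ_of_ne_zero hn.ne'
    obtain ⟨y, -, hy⟩ := hsub hx
    exact ⟨g^[l] y, by rwa [iterate_succ_apply'] at hy⟩
  · refine dense_iff_inter_open.mpr fun U hU hUne => ?_
    let mesh : Set unitI := ⋃ k ∈ {k | k ≤ N}, {x : unitI | (N : ℝ) * x = k}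
    have hN' : (N : ℝ) ≠ 0 := by positivity
    have hfin : mesh.Finite := by
      refine (finite_le_nat N).biUnion fun k _ => Subsingleton.finite ?_
      intro x hx y hy
      exact Subtype.ext (mul_left_cancel₀ hN' (Eq.trans hx (Eq.symm hy)))
    obtain ⟨x, hxU, -, hx⟩ := (dense_univ.sdiff_finite hfin).inter_open_nonempty U hU hUne
    obtain ⟨b, hbx, hb⟩ := exists_uIcc_subset (hU.inter hfin.isClosed.isOpen_compl)
      (show x ∈ U ∩ meshᶜ from ⟨hxU, hx⟩)
    have hpre : IsPreconnected (uIcc x b) := ordConnected_uIcc.isPreconnected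
    obtain ⟨n, hn, j, hj, hxj, hsub⟩ := covers _ hpre ⟨x, left_mem_uIcc, b, right_mem_uIcc,
      hbx.symm⟩ x
    have not_mesh : ∀ y ∈ uIcc x b, ∀ k : ℕ, k ≤ N → (N : ℝ) * y ≠ k := by
      intro y hy k hk heq
      exact (hb hy).2 (mem_biUnion (show k ∈ {k | k ≤ N} from hk) heq)
    have grid : ∀ k ≤ N, ∃ y : unitI, (N : ℝ) * y = k := by
      intro k hk
      obtain ⟨y, hy⟩ := exists_grid_point (j := 8 * k) hN (by omega)
      push_cast at hy
      exact ⟨y, by linarith⟩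
    have hNpos : (0 : ℝ) < N := by positivity
    have hbj : b ∈ block N j := by
      obtain ⟨y, hy⟩ := grid j hj.le
      obtain ⟨z, hz⟩ := grid (j + 1) hj
      have hz' := hz
      push_cast at hz'
      constructor
      · by_contra! hlt
        refine not_mesh y (mem_uIcc.mpr (Or.inr ⟨?_, ?_⟩)) j hj.le hy
        · exact Subtype.coe_le_coe.mp (le_of_mul_le_mul_left (hlt.le.trans hy.ge) hNpos)
        · exact Subtype.coe_le_coe.mp (le_of_mul_le_mul_left (hy.le.trans hxj.1) hNpos)
      · by_contra! hlt
        refine not_mesh z (mem_uIcc.mpr (Or.inl ⟨?_, ?_⟩)) (j + 1) hj hz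
        · exact Subtype.coe_le_coe.mp (le_of_mul_le_mul_left (hxj.2.trans hz'.ge) hNpos)
        · exact Subtype.coe_le_coe.mp (le_of_mul_le_mul_left (hz'.le.trans hlt.le) hNpos)
    have hcont : Continuous g^[n] := g.continuous.iterate n
    obtain ⟨p, hp, hpx⟩ := hsub hxj
    obtain ⟨q, hq, hqb⟩ := hsub hbj
    obtain ⟨z, hz, hfix⟩ : ∃ z ∈ uIcc x b, g^[n] z = z := by
      rcases le_total x b with h | h
      · have hIcc := uIcc_of_le h
        exact hpre.intermediate_value₂ hp hq hcont.continuousOn continuousOn_id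
          (hpx.trans_le (hIcc ▸ hp).1) (le_of_le_of_eq (hIcc ▸ hq).2 hqb.symm)
      · have hIcc := uIcc_of_ge h
        exact hpre.intermediate_value₂ hq hp hcont.continuousOn continuousOn_id
          (hqb.trans_le (hIcc ▸ hq).1) (le_of_le_of_eq (hIcc ▸ hp).2 hpx.symm)
    exact ⟨z, (hb hz).1, n, hn, hfix⟩

theorem IsInterpolation.chainTransitive {N : ℕ} {v : ℕ → ℕ} {f g : C(unitI, unitI)}
    (hg : IsInterpolation N v g) (hN : 0 < N) (hvN : ∀ j ≤ 8 * N, v j ≤ N)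
    (hright : ∀ k, v (8 * k) ≠ v (8 * k + 1)) (hleft : ∀ k, v (8 * k + 7) ≠ v (8 * k + 8))
    (hdom : Dominates N g f) (hf : ChainTransitive f) : ChainTransitive g := by
  intro E hE ⟨e, he⟩ hmaps
  have hEE : MapsTo g E E := fun y hy => interior_subset (hmaps hy)
  have nbhd : ∀ x ∈ E, ∃ b ≠ g x, uIcc (g x) b ⊆ E := fun x hx =>
    let ⟨b, hb, hsub⟩ := exists_uIcc_subset isOpen_interior (hmaps hx)
    ⟨b, hb, hsub.trans interior_subset⟩
  obtain ⟨b, hb, hbE⟩ := nbhd e he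
  obtain ⟨n, m, hm, k, hk⟩ := hg.exists_mesh_mem_iterate hN
    ordConnected_uIcc.isPreconnected ⟨g e, left_mem_uIcc, b, right_mem_uIcc, hb.symm⟩
  have hmE : m ∈ E := (hEE.iterate n).image_subset (image_mono hbE hm)
  have hkN : k ≤ N := by
    have : (k : ℝ) ≤ N := hk ▸ mul_le_of_le_one_right (Nat.cast_nonneg _) m.2.2
    exact_mod_cast this
  obtain ⟨c, hc, hcE⟩ := nbhd m hmE
  obtain ⟨l, hl, i, hi, hsub⟩ := hg.exists_block_subset_iterate hN hvN hright hleft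
    ordConnected_uIcc.isPreconnected left_mem_uIcc right_mem_uIcc hc
    (hg.apply_grid (j := 8 * k) hN (by omega) (by push_cast; linarith))
  refine eq_univ_of_forall fun x => ?_
  obtain ⟨r, -, j, -, hxj, hj⟩ := hdom.iterate_covers hN hf hl hi hsub x
  exact (hEE.iterate r).image_subset (image_mono hcE (hj hxj))

/-- The values `v j` stay close to those of `f` on the block containing `j / (8 * N)`, and on each
block they reach below and above all the blocks met by the image under `f`. -/
structure Follows (N : ℕ) (v : ℕ → ℕ) (f : C(unitI, unitI)) : Prop where
  le : ∀ j ≤ 8 * N, v j ≤ N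
  near : ∀ j ≤ 8 * N, ∃ x ∈ block N (j / 8), |(v j : ℝ) - N * f x| ≤ 2
  low : ∀ i < N, ∀ k < N, ∀ x ∈ block N i, f x ∈ block N k →
    ∃ r, 0 < r ∧ r < 5 ∧ v (8 * i + r) ≤ k
  high : ∀ i < N, ∀ k < N, ∀ x ∈ block N i, f x ∈ block N k →
    ∃ r, 0 < r ∧ r < 5 ∧ k + 1 ≤ v (8 * i + r)

theorem exists_follows {N : ℕ} (hN : 0 < N) (f : C(unitI, unitI)) :
    ∃ v, Follows N v f ∧ ∀ j, v j ≠ v (j + 1) := by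
  have extremes : ∀ b, ∃ lo hi, lo < N ∧ hi < N ∧
      (b ≤ N → (∃ x ∈ block N b, f x ∈ block N lo) ∧ (∃ x ∈ block N b, f x ∈ block N hi)) ∧
      ∀ k < N, ∀ x ∈ block N b, f x ∈ block N k → lo ≤ k ∧ k ≤ hi := by
    intro b
    let T : Set ℕ := {k | k < N ∧ ∃ x ∈ block N b, f x ∈ block N k}
    have hfin : T.Finite := (finite_lt_nat N).subset fun k hk => hk.1
    by_cases hT : T.Nonempty
    · obtain ⟨lo, hlo, hlo'⟩ := exists_min_image T id hfin hT
      obtain ⟨hi, hhi, hhi'⟩ := exists_max_image T id hfin hT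
      exact ⟨lo, hi, hlo.1, hhi.1, fun _ => ⟨hlo.2, hhi.2⟩, fun k hk x hx hfx =>
        ⟨hlo' k ⟨hk, x, hx, hfx⟩, hhi' k ⟨hk, x, hx, hfx⟩⟩⟩
    · refine ⟨0, 0, hN, hN, fun hb => absurd ?_ hT, fun k hk x hx hfx =>
        absurd ⟨k, hk, x, hx, hfx⟩ hT⟩
      obtain ⟨y, hy⟩ := exists_grid_point (j := 8 * b) hN (by omega)
      push_cast at hy
      obtain ⟨k, hk, hyk⟩ := exists_mem_block hN (f y)
      exact ⟨k, hk, y, ⟨by linarith, by linarith⟩, hyk⟩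
  choose lo hi hloN hhiN hmem hext using extremes
  let t : ℕ → ℕ := fun j => if j % 8 = 3 ∨ j % 8 = 4 then hi (j / 8) + 1 else lo (j / 8)
  let v : ℕ → ℕ := fun j => if t j % 2 = j % 2 then t j else if t j = 0 then 1 else t j - 1
  have hv : ∀ j, v j % 2 = j % 2 ∧ v j ≤ t j + 1 ∧ t j ≤ v j + 1 ∧
      (t j % 2 = j % 2 → v j = t j) ∧ (t j ≤ N → v j ≤ N) := by
    intro j
    simp only [v]
    split_ifs <;> omega
  have hlow : ∀ i r, (r = 1 ∨ r = 2) → t (8 * i + r) = lo i := by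
    intro i r hr
    have h1 : (8 * i + r) / 8 = i := by omega
    simp only [t, h1]
    rw [if_neg (by omega)]
  have hhigh : ∀ i r, (r = 3 ∨ r = 4) → t (8 * i + r) = hi i + 1 := by
    intro i r hr
    have h1 : (8 * i + r) / 8 = i := by omega
    simp only [t, h1]
    rw [if_pos (by omega)]
  refine ⟨v, ⟨fun j _ => (hv j).2.2.2.2 ?_, fun j hj => ?_, ?_, ?_⟩, fun j => ?_⟩
  · simp only [t]
    split_ifs
    · exact hhiN _
    · exact (hloN _).le
  · obtain ⟨x, hx, hxt⟩ : ∃ x ∈ block N (j / 8), |(t j : ℝ) - N * f x| ≤ 1 := by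
      obtain ⟨⟨x, hx, hfx⟩, y, hy, hfy⟩ := hmem (j / 8) (by omega)
      simp only [t]
      split_ifs
      · refine ⟨y, hy, ?_⟩
        push_cast
        exact abs_le.mpr ⟨by linarith [hfy.2], by linarith [hfy.1]⟩
      · exact ⟨x, hx, abs_le.mpr ⟨by linarith [hfx.2], by linarith [hfx.1]⟩⟩
    have h1 : (v j : ℝ) ≤ t j + 1 := by exact_mod_cast (hv j).2.1
    have h2 : (t j : ℝ) ≤ v j + 1 := by exact_mod_cast (hv j).2.2.1
    rw [abs_le] at hxt
    exact ⟨x, hx, abs_le.mpr ⟨by linarith, by linarith⟩⟩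
  · intro i _ k hk x hx hfx
    have hle := (hext i k hk x hx hfx).1
    rcases Nat.mod_two_eq_zero_or_one (lo i) with h | h
    · refine ⟨2, by omega, by omega, ?_⟩
      rw [(hv _).2.2.2.1 (by rw [hlow i 2 (by omega)]; omega), hlow i 2 (by omega)]
      exact hle
    · refine ⟨1, by omega, by omega, ?_⟩
      rw [(hv _).2.2.2.1 (by rw [hlow i 1 (by omega)]; omega), hlow i 1 (by omega)]
      exact hle
  · intro i _ k hk x hx hfx
    have hle := (hext i k hk x hx hfx).2
    rcases Nat.mod_two_eq_zero_or_one (hi i) with h | h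
    · refine ⟨3, by omega, by omega, ?_⟩
      rw [(hv _).2.2.2.1 (by rw [hhigh i 3 (by omega)]; omega), hhigh i 3 (by omega)]
      omega
    · refine ⟨4, by omega, by omega, ?_⟩
      rw [(hv _).2.2.2.1 (by rw [hhigh i 4 (by omega)]; omega), hhigh i 4 (by omega)]
      omega
  · have h1 := (hv j).1
    have h2 := (hv (j + 1)).1
    omega

theorem Follows.dominates {N : ℕ} {v : ℕ → ℕ} {f g : C(unitI, unitI)} (hv : Follows N v f)
    (hN : 0 < N) (hg : IsInterpolation N v g) : Dominates N g f := by
  intro i hi k hk x hx hfx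
  have point : ∀ r < 5, ∃ y ∈ block N i, (N : ℝ) * g y = v (8 * i + r) := by
    intro r hr
    obtain ⟨y, hy⟩ := exists_grid_point (j := 8 * i + r) hN (by omega)
    refine ⟨y, ?_, hg.apply_grid hN (by omega) hy⟩
    have hr' : (r : ℝ) < 5 := by exact_mod_cast hr
    have hr0 : (0 : ℝ) ≤ r := r.cast_nonneg
    push_cast at hy
    exact ⟨by linarith, by linarith⟩
  obtain ⟨r, -, hr, hlow⟩ := hv.low i hi k hk x hx hfx
  obtain ⟨s, -, hs, hhigh⟩ := hv.high i hi k hk x hx hfx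
  obtain ⟨y, hy, hgy⟩ := point r hr
  obtain ⟨z, hz, hgz⟩ := point s hs
  refine block_subset_of_isPreconnected hN
    ((isPreconnected_block N i).image g g.continuous.continuousOn)
    (mem_image_of_mem _ hy) (mem_image_of_mem _ hz) ?_ ?_
  · rw [hgy]
    exact_mod_cast hlow
  · rw [hgz]
    exact_mod_cast hhigh

theorem exists_follows_dist_lt (f : C(unitI, unitI)) {ε : ℝ} (hε : 0 < ε) :
    ∃ N > 0, ∀ v, Follows N v f → ∀ g, IsInterpolation N v g → dist f g < ε := by
  have hunif := CompactSpace.uniformContinuous_of_continuous f.continuous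
  obtain ⟨δ, hδ, hfδ⟩ := Metric.uniformContinuous_iff.mp hunif (ε / 4) (by positivity)
  obtain ⟨N, hN⟩ := exists_nat_gt (max (2 / δ) (8 / ε))
  have hN' : (0 : ℝ) < N := lt_of_le_of_lt (le_max_of_le_left (by positivity)) hN
  have hNδ : 2 < N * δ := (div_lt_iff₀ hδ).mp ((le_max_left _ _).trans_lt hN)
  have hNε : 8 < N * ε := (div_lt_iff₀ hε).mp ((le_max_right _ _).trans_lt hN)
  have hNpos : 0 < N := Nat.cast_pos.mp hN'
  refine ⟨N, hNpos, fun v hv g hg => (ContinuousMap.dist_lt_iff hε).mpr fun x => ?_⟩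
  obtain ⟨j, hj, h1, h2⟩ := exists_cell hNpos x
  have close : ∀ l ≤ 8 * N, (l : ℝ) ≤ j + 1 → (j : ℝ) ≤ l →
      |(v l : ℝ) - N * f x| < N * ε / 2 := by
    intro l hl hlj hjl
    obtain ⟨y, hy, hvy⟩ := hv.near l hl
    have hdiv1 : ((l / 8 : ℕ) : ℝ) * 8 ≤ l := by exact_mod_cast Nat.div_mul_le_self l 8
    have hdiv2 : (l : ℝ) ≤ ((l / 8 : ℕ) : ℝ) * 8 + 7 := by
      have : l ≤ l / 8 * 8 + 7 := by omega
      exact_mod_cast this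
    have hxy : dist x y < δ := by
      rw [Subtype.dist_eq, Real.dist_eq]
      have : N * |(x : ℝ) - y| < N * δ := by
        rw [← abs_of_pos hN', ← abs_mul, abs_of_pos hN']
        refine lt_of_le_of_lt (abs_le.mpr ⟨?_, ?_⟩) hNδ
        · linarith [hy.2]
        · linarith [hy.1]
      exact lt_of_mul_lt_mul_left this hN'.le
    have hf := hfδ hxy
    rw [Subtype.dist_eq, Real.dist_eq, abs_lt] at hf
    rw [abs_le] at hvy
    have hf1 := mul_lt_mul_of_pos_left hf.1 hN'
    have hf2 := mul_lt_mul_of_pos_left hf.2 hN'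
    rw [abs_lt]
    constructor <;> linarith
  have c1 := abs_lt.mp (close j hj.le (by linarith) le_rfl)
  have c2 := abs_lt.mp (close (j + 1) hj (by push_cast; rfl) (by push_cast; linarith))
  have hgx := hg j hj x h1 h2
  set s : ℝ := 8 * N * x - j with hs
  have hs0 : 0 ≤ s := by linarith
  have hs1 : 0 ≤ 1 - s := by linarith
  have hεN : 0 < N * ε := by positivity
  rw [Subtype.dist_eq, Real.dist_eq]
  have hfinal : N * |(f x : ℝ) - g x| < N * ε := by
    rw [← abs_of_pos hN', ← abs_mul, abs_of_pos hN', abs_lt, mul_sub, hgx]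
    constructor
    · nlinarith [mul_nonneg hs0 (sub_nonneg.mpr c2.2.le), mul_nonneg hs1 (sub_nonneg.mpr c1.2.le)]
    · nlinarith [mul_nonneg hs0 (sub_nonneg.mpr c2.1.le), mul_nonneg hs1 (sub_nonneg.mpr c1.1.le)]
  exact lt_of_mul_lt_mul_left hfinal hN'.le

theorem ChainTransitive.mem_closure_CP {f : C(unitI, unitI)} (hf : ChainTransitive f) :
    f ∈ closure CP := by
  refine Metric.mem_closure_iff.mpr fun ε hε => ?_
  obtain ⟨N, hN, hdist⟩ := exists_follows_dist_lt f hε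
  obtain ⟨v, hv, hne⟩ := exists_follows hN f
  obtain ⟨g, hg⟩ := exists_isInterpolation hN hv.le
  exact ⟨g, hg.mem_CP hN hv.le hne (hv.dominates hN hg) hf, hdist v hv g hg⟩

theorem Follows.update {N : ℕ} {v : ℕ → ℕ} {f : C(unitI, unitI)} (hv : Follows N v f) :
    Follows N (update v 6 (v 5)) f where
  le j hj := by
    rcases eq_or_ne j 6 with rfl | h
    · rw [update_self]
      exact hv.le 5 (by omega)
    · rw [update_of_ne h]
      exact hv.le j hj
  near j hj := by
    rcases eq_or_ne j 6 with rfl | h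
    · rw [update_self]
      exact hv.near 5 (by omega)
    · rw [update_of_ne h]
      exact hv.near j hj
  low i hi k hk x hx hfx := by
    obtain ⟨r, h0, h5, h⟩ := hv.low i hi k hk x hx hfx
    exact ⟨r, h0, h5, by rwa [update_of_ne (by omega)]⟩
  high i hi k hk x hx hfx := by
    obtain ⟨r, h0, h5, h⟩ := hv.high i hi k hk x hx hfx
    exact ⟨r, h0, h5, by rwa [update_of_ne (by omega)]⟩

theorem IsInterpolation.notMem_CP {N : ℕ} {v : ℕ → ℕ} {g : C(unitI, unitI)}
    (hg : IsInterpolation N v g) (hN : 0 < N) {j : ℕ} (hj : j < 8 * N)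
    (hv : v (j + 1) = v j) : g ∉ CP := by
  intro hgCP
  have hN' : (0 : ℝ) < N := Nat.cast_pos.mpr hN
  let W : Set unitI := {x | (j : ℝ) < 8 * N * x} ∩ {x | 8 * (N : ℝ) * x < j + 1}
  have hW : IsOpen W :=
    (isOpen_lt (by fun_prop) (by fun_prop)).inter (isOpen_lt (by fun_prop) (by fun_prop))
  have hWne : W.Nonempty := by
    have hj' : (j : ℝ) + 1 ≤ 8 * N := by exact_mod_cast hj
    have hx : 8 * (N : ℝ) * ((j + 1 / 2) / (8 * N)) = j + 1 / 2 := by field_simp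
    refine ⟨⟨(j + 1 / 2) / (8 * N), by positivity, ?_⟩, ?_, ?_⟩
    · rw [div_le_one (by positivity)]
      linarith
    · change (j : ℝ) < 8 * N * ((j + 1 / 2) / (8 * N))
      linarith
    · change 8 * (N : ℝ) * ((j + 1 / 2) / (8 * N)) < j + 1
      linarith
  have value : ∀ x ∈ W, (N : ℝ) * g x = v j := by
    intro x hx
    rw [hg j hj x (le_of_lt hx.1) (le_of_lt hx.2), hv]
    ring
  obtain ⟨p, hpW, hp⟩ := hgCP.2.inter_open_nonempty W hW hWne
  obtain ⟨q, hqW, hq, hqp⟩ :=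
    (hgCP.2.sdiff_finite (finite_singleton p)).inter_open_nonempty W hW hWne
  refine hqp ((bijOn_periodicPts g).injOn hq hp (Subtype.ext (mul_left_cancel₀ hN'.ne' ?_)))
  rw [value p hpW, value q hqW]

theorem ChainTransitive.exists_notMem_CP {f : C(unitI, unitI)} (hf : ChainTransitive f) {ε : ℝ}
    (hε : 0 < ε) : ∃ g, ChainTransitive g ∧ g ∉ CP ∧ dist f g < ε := by
  obtain ⟨N, hN, hdist⟩ := exists_follows_dist_lt f hε
  obtain ⟨v, hv, hne⟩ := exists_follows hN f
  obtain ⟨g, hg⟩ := exists_isInterpolation hN hv.update.le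
  refine ⟨g, hg.chainTransitive hN hv.update.le (fun k => ?_) (fun k => ?_)
    (hv.update.dominates hN hg) hf, hg.notMem_CP (j := 5) hN (by omega) ?_,
    hdist _ hv.update g hg⟩
  · rw [update_of_ne (by omega), update_of_ne (by omega)]
    exact hne _
  · rw [update_of_ne (by omega), update_of_ne (by omega)]
    exact hne _
  · rw [update_self, update_of_ne (by omega)]

/-- The set `cl(CP) \ CP` is dense in `cl(CP)` (with the uniform metric). -/
theorem closure_CP_diff_CP_dense :
    ∀ f ∈ closure CP, ∀ ε : ℝ, 0 < ε →
      ∃ g ∈ closure CP \ CP, dist f g < ε := by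
  intro f hf ε hε
  obtain ⟨f', hf', hdist⟩ := Metric.mem_closure_iff.mp hf (ε / 2) (by positivity)
  obtain ⟨g, hg, hgCP, hdist'⟩ :=
    (chainTransitive_of_mem_CP hf').exists_notMem_CP (half_pos hε)
  exact ⟨g, ⟨hg.mem_closure_CP, hgCP⟩, by linarith [dist_triangle f f' g]⟩
end

section
/- The spaces (CP, ρ) and (cl(CP), ρ) are uniformly locally arcwise connected: for every ε > 0 there is δ > 0 such that whenever two maps f, g in the space satisfy 0 < ρ(f,g) < δ, there exists an arc in the space joining f and g whose diameter is smaller than ε. -/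
open Set Function Metric

/-- A subset `S` of `C(I,I)` is uniformly locally arcwise connected if for every
`ε > 0` there is `δ > 0` such that any `f, g ∈ S` with `0 < ρ(f,g) < δ` are joined
by an arc (image of a continuous injective path) in `S` of diameter smaller than `ε`. -/
def UnifLocArcwiseConnected (S : Set C(unitI, unitI)) : Prop :=
  ∀ ε : ℝ, 0 < ε → ∃ δ : ℝ, 0 < δ ∧
    ∀ f ∈ S, ∀ g ∈ S, 0 < dist f g → dist f g < δ →
      ∃ γ : unitI → C(unitI, unitI), Continuous γ ∧ Function.Injective γ ∧
        γ ⟨0, by norm_num⟩ = f ∧ γ ⟨1, by norm_num⟩ = g ∧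
        Set.range γ ⊆ S ∧ Metric.diam (Set.range γ) < ε

/-! ### Elementary real functions -/

/-- A `1`-Lipschitz retraction of `[-1, 2]` onto `[0, 1]` that reflects at the end points. -/
noncomputable def reflect (y : ℝ) : ℝ := 1 - |1 - (|y|)|

lemma continuous_reflect : Continuous reflect := by
  unfold reflect
  fun_prop

lemma reflect_of_mem {y : ℝ} (h0 : 0 ≤ y) (h1 : y ≤ 1) : reflect y = y := by
  rw [reflect, abs_of_nonneg h0, abs_of_nonneg (by linarith)]
  ring

lemma reflect_of_nonpos {y : ℝ} (h0 : -1 ≤ y) (h1 : y ≤ 0) : reflect y = -y := by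
  rw [reflect, abs_of_nonpos h1, abs_of_nonneg (by linarith)]
  ring

lemma reflect_of_one_le {y : ℝ} (h : 1 ≤ y) : reflect y = 2 - y := by
  rw [reflect, abs_of_nonneg (zero_le_one.trans h), abs_of_nonpos (by linarith)]
  ring

lemma reflect_mem_Icc {y : ℝ} (h0 : -1 ≤ y) (h1 : y ≤ 2) : reflect y ∈ Icc (0 : ℝ) 1 := by
  have : |y| ≤ 2 := abs_le.2 ⟨by linarith, h1⟩
  have h2 : |1 - (|y|)| ≤ 1 := abs_le.2 ⟨by linarith, by linarith [abs_nonneg y]⟩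
  exact ⟨by unfold reflect; linarith, by unfold reflect; linarith [abs_nonneg (1 - (|y|))]⟩

lemma abs_reflect_sub_le (x y : ℝ) : |reflect x - reflect y| ≤ |x - y| := by
  calc |reflect x - reflect y| = |(|1 - (|y|)|) - (|1 - (|x|)|)| := by unfold reflect; ring_nf
    _ ≤ |(1 - (|y|)) - (1 - (|x|))| := abs_abs_sub_abs_le _ _
    _ = |(|x|) - (|y|)| := by ring_nf
    _ ≤ |x - y| := abs_abs_sub_abs_le _ _

/-- The reflection shrinks intervals at most by a factor of `3`. -/
lemma exists_le_abs_reflect_sub {A B : ℝ} (hA : -1 ≤ A) (hAB : A ≤ B) (hB : B ≤ 2) :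
    ∃ C ∈ Icc A B, ∃ D ∈ Icc A B, B - A ≤ 3 * |reflect C - reflect D| := by
  have key : ∀ C D : ℝ, -1 ≤ C → C ≤ D → D ≤ 2 → (D ≤ 0 ∨ (0 ≤ C ∧ D ≤ 1) ∨ 1 ≤ C) →
      |reflect C - reflect D| = D - C := by
    rintro C D hC hCD hD (h | ⟨h, h'⟩ | h)
    · rw [reflect_of_nonpos hC (by linarith), reflect_of_nonpos (by linarith) h,
        abs_of_nonneg (by linarith)]
      ring
    · rw [reflect_of_mem h (by linarith), reflect_of_mem (by linarith) h',
        abs_of_nonpos (by linarith)]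
      ring
    · rw [reflect_of_one_le h, reflect_of_one_le (by linarith), abs_of_nonneg (by linarith)]
      ring
  obtain ⟨P, hAP, hPB, hP⟩ : ∃ P, A ≤ P ∧ P ≤ B ∧ ((A = P ∧ 0 ≤ P) ∨ P = 0 ∨ (P = B ∧ P ≤ 0)) := by
    rcases le_total 0 A with h | h
    · exact ⟨A, le_rfl, hAB, Or.inl ⟨rfl, h⟩⟩
    rcases le_total B 0 with h' | h'
    · exact ⟨B, hAB, le_rfl, by simp [h']⟩
    · exact ⟨0, h, h', by simp⟩
  obtain ⟨Q, hPQ, hQB, hQ⟩ : ∃ Q, P ≤ Q ∧ Q ≤ B ∧ ((P = Q ∧ 1 ≤ Q) ∨ Q = 1 ∨ (Q = B ∧ Q ≤ 1)) := by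
    rcases le_total 1 P with h | h
    · exact ⟨P, le_rfl, hPB, Or.inl ⟨rfl, h⟩⟩
    rcases le_total B 1 with h' | h'
    · exact ⟨B, hPB, le_rfl, by simp [h']⟩
    · exact ⟨1, h, h', by simp⟩
  by_cases h1 : B - A ≤ 3 * (P - A)
  · refine ⟨A, ⟨le_rfl, hAB⟩, P, ⟨hAP, hPB⟩, ?_⟩
    rcases hP with ⟨h, h'⟩ | h | ⟨h, h'⟩
    · have : B - A ≤ 0 := by linarith
      linarith [abs_nonneg (reflect A - reflect P)]
    · rwa [key A P hA hAP (by linarith) (Or.inl h.le)]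
    · rwa [key A P hA hAP (by linarith) (Or.inl h')]
  by_cases h2 : B - A ≤ 3 * (B - Q)
  · refine ⟨Q, ⟨by linarith, hQB⟩, B, ⟨hAB, le_rfl⟩, ?_⟩
    rcases hQ with ⟨h, h'⟩ | h | ⟨h, h'⟩
    · rwa [key Q B (by linarith) hQB hB (by simp [h'])]
    · rwa [key Q B (by linarith) hQB hB (by simp [h])]
    · have : B - A ≤ 0 := by linarith
      linarith [abs_nonneg (reflect Q - reflect B)]
  · refine ⟨P, ⟨hAP, hPB⟩, Q, ⟨by linarith, hQB⟩, ?_⟩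
    rw [key P Q (by linarith) hPQ (by linarith) ?_]
    · linarith
    · rcases hP with ⟨h, h'⟩ | h | ⟨h, h'⟩
      · rcases hQ with ⟨k, k'⟩ | k | ⟨k, k'⟩
        · right; right; linarith
        · right; left; exact ⟨h', k.le⟩
        · right; left; exact ⟨h', k'⟩
      · rcases hQ with ⟨k, k'⟩ | k | ⟨k, k'⟩
        · linarith
        · right; left; exact ⟨h.ge, k.le⟩
        · right; left; exact ⟨h.ge, k'⟩
      · left; linarith

/-- The triangle wave with values in `[-1, 1]`, slope `±2`, and turning points `m + 1/2`. -/
noncomputable def zigzag (y : ℝ) : ℝ := 2 / Real.pi * Real.arcsin (Real.sin (Real.pi * y))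

lemma continuous_zigzag : Continuous zigzag := by
  unfold zigzag
  exact continuous_const.mul (Real.continuous_arcsin.comp (by fun_prop))

lemma zigzag_zero : zigzag 0 = 0 := by simp [zigzag]

lemma abs_zigzag_le (y : ℝ) : |zigzag y| ≤ 1 := by
  have hpi := Real.pi_pos
  rw [zigzag, abs_mul, abs_of_pos (by positivity)]
  have : |Real.arcsin (Real.sin (Real.pi * y))| ≤ Real.pi / 2 :=
    abs_le.2 ⟨by linarith [Real.neg_pi_div_two_le_arcsin (Real.sin (Real.pi * y))],
      Real.arcsin_le_pi_div_two _⟩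
  calc 2 / Real.pi * |Real.arcsin (Real.sin (Real.pi * y))| ≤ 2 / Real.pi * (Real.pi / 2) := by
        gcongr
    _ = 1 := by field_simp

lemma zigzag_eq (m : ℤ) {y : ℝ} (h : |y - m| ≤ 1 / 2) : zigzag y = (-1) ^ m * (2 * (y - m)) := by
  have hpi := Real.pi_pos
  obtain ⟨h1, h2⟩ := abs_le.1 h
  have hs : Real.arcsin (Real.sin (Real.pi * (y - m))) = Real.pi * (y - m) :=
    Real.arcsin_sin (by nlinarith) (by nlinarith)
  have e : Real.sin (Real.pi * y) = (-1) ^ m * Real.sin (Real.pi * (y - m)) := by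
    have := Real.sin_sub_int_mul_pi (Real.pi * y) m
    rw [show Real.pi * (y - m) = Real.pi * y - m * Real.pi by ring, this, ← mul_assoc,
      ← mul_zpow]
    simp
  rw [zigzag, e]
  rcases Int.even_or_odd m with hm | hm
  · rw [hm.neg_one_zpow, one_mul, hs]
    field_simp
  · rw [hm.neg_one_zpow, neg_one_mul, Real.arcsin_neg, hs]
    field_simp

lemma abs_zigzag_sub (m : ℤ) {y z : ℝ} (hy : |y - m| ≤ 1 / 2) (hz : |z - m| ≤ 1 / 2) :
    |zigzag y - zigzag z| = 2 * |y - z| := by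
  rw [zigzag_eq m hy, zigzag_eq m hz, ← mul_sub, abs_mul, abs_zpow, abs_neg, abs_one, one_zpow,
    one_mul, ← mul_sub, abs_mul]
  norm_num

/-! ### Dynamics on the interval -/

lemma image_Icc_of_endpoints (h : C(unitI, unitI)) {c d u v : unitI} (hu : u ∈ Icc c d)
    (hv : v ∈ Icc c d) : Icc (h u) (h v) ⊆ h '' Icc c d :=
  isPreconnected_Icc.intermediate_value hu hv h.continuous.continuousOn

lemma exists_isFixedPt_of_Icc_subset_image {φ : unitI → unitI} (hφ : Continuous φ) {a b : unitI}
    (hab : a ≤ b) (h : Icc a b ⊆ φ '' Icc a b) : ∃ c ∈ Icc a b, IsFixedPt φ c := by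
  obtain ⟨u, hu, hua⟩ := h (left_mem_Icc.2 hab)
  obtain ⟨v, hv, hvb⟩ := h (right_mem_Icc.2 hab)
  exact isPreconnected_Icc.intermediate_value₂ hu hv hφ.continuousOn continuousOn_id
    (hua.trans_le hu.1) (hv.2.trans_eq hvb.symm)

/-- A map that doubles the length of every interval containing no interval of a given family
eventually maps every interval over a member of that family. -/
lemma exists_iterate_image_superset {h : C(unitI, unitI)} {Lap : unitI → unitI → Prop}
    (hexp : ∀ c d : unitI, c < d → (∃ p q, Lap p q ∧ Icc p q ⊆ Icc c d) ∨
      ∃ u ∈ Icc c d, ∃ v ∈ Icc c d, 2 * ((d : ℝ) - c) ≤ (h v : ℝ) - h u)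
    {c d : unitI} (hcd : c < d) : ∃ n p q, Lap p q ∧ Icc p q ⊆ h^[n] '' Icc c d := by
  by_contra! hcon
  have hpos : (0 : ℝ) < d - c := sub_pos.2 hcd
  have grow : ∀ n : ℕ, ∃ u v : unitI, Icc u v ⊆ h^[n] '' Icc c d ∧
      2 ^ n * ((d : ℝ) - c) ≤ (v : ℝ) - u := by
    intro n
    induction n with
    | zero => exact ⟨c, d, by simp, by simp⟩
    | succ n ih =>
      obtain ⟨u, v, huv, hlen⟩ := ih
      have hlt : u < v := by
        have : (0 : ℝ) < v - u := lt_of_lt_of_le (by positivity) hlen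
        exact Subtype.coe_lt_coe.1 (sub_pos.1 this)
      rcases hexp u v hlt with ⟨p, q, hL, hpq⟩ | ⟨u', hu', v', hv', hlen'⟩
      · exact absurd (hpq.trans huv) (hcon n p q hL)
      · refine ⟨h u', h v', ?_, ?_⟩
        · rw [iterate_succ', image_comp]
          exact (image_Icc_of_endpoints h hu' hv').trans (image_mono huv)
        · rw [pow_succ]
          linarith
  obtain ⟨n, hn⟩ := pow_unbounded_of_one_lt (1 / ((d : ℝ) - c)) one_lt_two
  obtain ⟨u, v, -, hlen⟩ := grow n
  rw [div_lt_iff₀ hpos] at hn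
  linarith [v.2.2, u.2.1]

/-- If `h` maps `ρ`-balls over `ρ`-balls following `σ`-pseudo-orbits of a map with dense periodic
points, then iterates of any `ρ`-ball cover all `ρ`-balls. -/
lemma exists_iterate_image_superset_closedBall {f h : C(unitI, unitI)}
    (hf : Dense (periodicPts f)) {ρ σ : ℝ} (hσ : 0 < σ)
    (hcov : ∀ y y' : unitI, dist y' (f y) ≤ σ → closedBall y' ρ ⊆ h '' closedBall y ρ)
    (y₀ y : unitI) : ∃ m, closedBall y ρ ⊆ h^[m] '' closedBall y₀ ρ := by
  set R : Set unitI := {y | ∃ m, closedBall y ρ ⊆ h^[m] '' closedBall y₀ ρ}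
  have step : ∀ y ∈ R, ∀ y', dist y' (f y) ≤ σ → y' ∈ R := by
    rintro y ⟨m, hm⟩ y' hy'
    refine ⟨m + 1, ?_⟩
    rw [iterate_succ', image_comp]
    exact (hcov y y' hy').trans (image_mono hm)
  have spread : ∀ y ∈ R, ∀ y', dist y' y < σ / 2 → y' ∈ R := by
    intro y hy y' hy'
    have hopen : IsOpen (ball y (σ / 2) ∩ f ⁻¹' ball (f y) σ) :=
      isOpen_ball.inter (isOpen_ball.preimage f.continuous)
    obtain ⟨p, ⟨hpy, hpf⟩, n, hn, hper⟩ := hf.inter_open_nonempty _ hopen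
      ⟨y, mem_ball_self (by positivity), mem_ball_self hσ⟩
    have horb : ∀ k, f^[k + 1] p ∈ R := by
      intro k
      induction k with
      | zero => exact step y hy _ (le_of_lt hpf)
      | succ k ih =>
        refine step _ ih _ ?_
        rw [iterate_succ_apply' f (k + 1), dist_self]
        exact hσ.le
    have hpR : p ∈ R := by
      obtain ⟨k, rfl⟩ := Nat.exists_eq_add_of_lt hn
      have := horb k
      rwa [show k + 1 = 0 + k + 1 by ring, hper] at this
    have hlast : ∃ q ∈ R, f q = p := by
      obtain ⟨k, rfl⟩ := Nat.exists_eq_add_of_lt hn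
      rw [zero_add] at hper
      rcases k with - | k
      · exact ⟨p, hpR, hper⟩
      · refine ⟨_, horb k, ?_⟩
        rw [← iterate_succ_apply' f (k + 1)]
        exact hper
    obtain ⟨q, hqR, rfl⟩ := hlast
    refine step q hqR y' ?_
    have := dist_triangle y' y (f q)
    rw [mem_ball, dist_comm] at hpy
    linarith
  have hclopen : IsClopen R := by
    refine ⟨⟨isOpen_iff.2 fun y hy => ⟨σ / 2, by positivity, fun y' hy' hR => hy ?_⟩⟩,
      isOpen_iff.2 fun y hy => ⟨σ / 2, by positivity, fun y' hy' => spread y hy y' hy'⟩⟩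
    exact spread y' hR y (by rwa [dist_comm])
  have huniv : R = univ := hclopen.eq_univ ⟨y₀, 0, by simp⟩
  exact huniv.ge (mem_univ y)

/-- A criterion for membership in `CP`. -/
lemma mem_CP_of_expanding_of_covering {f h : C(unitI, unitI)} (hf : f ∈ CP)
    {Lap : unitI → unitI → Prop} {ρ σ : ℝ} (hρ : 0 < ρ) (hσ : 0 < σ)
    (hexp : ∀ c d : unitI, c < d → (∃ p q, Lap p q ∧ Icc p q ⊆ Icc c d) ∨
      ∃ u ∈ Icc c d, ∃ v ∈ Icc c d, 2 * ((d : ℝ) - c) ≤ (h v : ℝ) - h u)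
    (hlap : ∀ p q, Lap p q → ∃ y, closedBall y ρ ⊆ h '' Icc p q)
    (hcov : ∀ y y' : unitI, dist y' (f y) ≤ σ → closedBall y' ρ ⊆ h '' closedBall y ρ) :
    h ∈ CP := by
  have hdense : Dense (periodicPts h) := by
    refine dense_of_exists_between fun a b hab => ?_
    obtain ⟨a', haa₁, ha₁b⟩ := exists_between hab
    obtain ⟨b', hab₁, hb₁b, hsmall⟩ : ∃ b', a' < b' ∧ b' < b ∧ (b' : ℝ) ≤ a' + ρ := by
      have h1 : (a' : ℝ) < min (b : ℝ) (a' + ρ) := lt_min ha₁b (by linarith)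
      obtain ⟨r, hr1, hr2⟩ := exists_between h1
      have hrb : r < b := hr2.trans_le (min_le_left _ _)
      exact ⟨⟨r, by linarith [a'.2.1], by linarith [b.2.2]⟩, hr1, hrb,
        (hr2.trans_le (min_le_right _ _)).le⟩
    obtain ⟨n, p, q, hL, hpq⟩ := exists_iterate_image_superset hexp hab₁
    obtain ⟨y, hy⟩ := hlap p q hL
    obtain ⟨m, hm⟩ := exists_iterate_image_superset_closedBall hf.2 hσ hcov y a'
    have hball : Icc a' b' ⊆ closedBall a' ρ := by
      intro x hx
      have h1 : (a' : ℝ) ≤ x := hx.1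
      have h2 : (x : ℝ) ≤ b' := hx.2
      rw [mem_closedBall, Subtype.dist_eq, Real.dist_eq, abs_of_nonneg (by linarith)]
      linarith
    have hsub : Icc a' b' ⊆ h^[m + 1 + n] '' Icc a' b' := by
      rw [iterate_add, image_comp, iterate_add, image_comp, iterate_one]
      exact hball.trans (hm.trans (image_mono (hy.trans (image_mono hpq))))
    obtain ⟨c, hc, hfix⟩ :=
      exists_isFixedPt_of_Icc_subset_image (h.continuous.iterate _) hab₁.le hsub
    exact ⟨c, ⟨m + 1 + n, by omega, hfix⟩, haa₁.trans_le hc.1, hc.2.trans_lt hb₁b⟩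
  refine ⟨fun y => ?_, hdense⟩
  have hclosed : IsClosed (range h) := (isCompact_range h.continuous).isClosed
  have hsub : periodicPts h ⊆ range h := by
    rintro x ⟨n, hn, hx⟩
    obtain ⟨k, rfl⟩ := Nat.exists_eq_add_of_lt hn
    exact ⟨h^[0 + k] x, by rw [← iterate_succ_apply' h]; exact hx⟩
  exact (hclosed.closure_subset_iff.2 hsub) (hdense y)

/-! ### Adding a triangle wave -/

/-- The function `F` plus a triangle wave of amplitude `a` and frequency `N` vanishing at `x₀`. -/
noncomputable def addWave (x₀ : ℝ) (F : C(unitI, ℝ)) (a N : ℝ) : C(unitI, ℝ) where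
  toFun x := F x + a * zigzag (N * (x - x₀))
  continuous_toFun := by
    have := continuous_zigzag
    fun_prop

/-- The self-map of `I` obtained from `addWave` by reflecting at the end points of `I`. -/
noncomputable def wiggle (x₀ : ℝ) (F : C(unitI, ℝ)) (a N : ℝ) : C(unitI, unitI) where
  toFun x := projIcc 0 1 zero_le_one (reflect (addWave x₀ F a N x))
  continuous_toFun :=
    continuous_projIcc.comp (continuous_reflect.comp (addWave x₀ F a N).continuous)

lemma addWave_apply (x₀ : ℝ) (F : C(unitI, ℝ)) (a N : ℝ) (x : unitI) :
    addWave x₀ F a N x = F x + a * zigzag (N * (x - x₀)) := rfl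

lemma abs_addWave_sub_le (x₀ : ℝ) (F : C(unitI, ℝ)) {a : ℝ} (ha : 0 ≤ a) (N : ℝ) (x : unitI) :
    |addWave x₀ F a N x - F x| ≤ a := by
  rw [addWave_apply, add_sub_cancel_left, abs_mul, abs_of_nonneg ha]
  exact mul_le_of_le_one_right ha (abs_zigzag_le _)

lemma coe_wiggle {x₀ : ℝ} {F : C(unitI, ℝ)} {a N : ℝ} {x : unitI}
    (hx : addWave x₀ F a N x ∈ Icc (-1 : ℝ) 2) :
    (wiggle x₀ F a N x : ℝ) = reflect (addWave x₀ F a N x) := by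
  change ((projIcc 0 1 zero_le_one (reflect (addWave x₀ F a N x)) : unitI) : ℝ) = _
  rw [projIcc_of_mem _ (reflect_mem_Icc hx.1 hx.2)]

lemma addWave_mem_Icc {x₀ : ℝ} {F : C(unitI, ℝ)} {f : unitI → unitI} {a N : ℝ} (ha₀ : 0 ≤ a)
    (ha₁ : a ≤ 1 / 2) {x : unitI} (hFf : |F x - f x| ≤ a / 10) :
    addWave x₀ F a N x ∈ Icc (-1 : ℝ) 2 := by
  have h1 := abs_le.1 (abs_addWave_sub_le x₀ F ha₀ N x)
  have h2 := abs_le.1 hFf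
  have h3 := (f x).2
  constructor <;> linarith [h3.1, h3.2]

/-- `[p, q]` is the `m`-th maximal interval of monotonicity of the wave of frequency `N`. -/
def IsLap (x₀ N : ℝ) (m : ℤ) (p q : unitI) : Prop :=
  N * (p - x₀) = m - 1 / 2 ∧ N * (q - x₀) = m + 1 / 2

lemma IsLap.sub_eq {x₀ N : ℝ} (hN : 0 < N) {m : ℤ} {p q : unitI} (h : IsLap x₀ N m p q) :
    (q : ℝ) - p = 1 / N := by
  rw [eq_div_iff hN.ne']
  linarith [h.1, h.2]

lemma exists_isLap {x₀ N : ℝ} (hN : 0 < N) (m : ℤ) {c d : unitI} (hc : N * (c - x₀) ≤ m - 1 / 2)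
    (hd : m + 1 / 2 ≤ N * (d - x₀)) :
    ∃ p q, IsLap x₀ N m p q ∧ Icc p q ⊆ Icc c d := by
  have hcp : (c : ℝ) ≤ x₀ + (m - 1 / 2) / N := by
    have : (c : ℝ) - x₀ ≤ (m - 1 / 2) / N := by
      rw [le_div_iff₀ hN]; linarith
    linarith
  have hqd : x₀ + (m + 1 / 2) / N ≤ (d : ℝ) := by
    have : (m + 1 / 2) / N ≤ (d : ℝ) - x₀ := by
      rw [div_le_iff₀ hN]; linarith
    linarith
  have hpq : x₀ + (m - 1 / 2) / N ≤ x₀ + (m + 1 / 2) / N := by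
    gcongr
    linarith
  refine ⟨⟨x₀ + (m - 1 / 2) / N, by linarith [c.2.1], by linarith [d.2.2]⟩,
    ⟨x₀ + (m + 1 / 2) / N, by linarith [c.2.1], by linarith [d.2.2]⟩, ⟨?_, ?_⟩,
    Icc_subset_Icc hcp hqd⟩
  · simp only [add_sub_cancel_left]
    field_simp
  · simp only [add_sub_cancel_left]
    field_simp

lemma exists_isLap_closedBall (x₀ : ℝ) {N : ℝ} (hN : 4 ≤ N) (y : unitI) :
    ∃ m p q, IsLap x₀ N m p q ∧ Icc p q ⊆ closedBall y (2 / N) := by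
  have hN0 : 0 < N := by linarith
  have hN2 : 2 / N ≤ 1 / 2 := by
    rw [div_le_iff₀ hN0]; linarith
  have hN2' : 0 < 2 / N := by positivity
  obtain ⟨c, d, hcd, hsub⟩ : ∃ c d : unitI, (d : ℝ) = c + 2 / N ∧
      Icc c d ⊆ closedBall y (2 / N) := by
    rcases le_total (y : ℝ) (1 / 2) with hy | hy
    · refine ⟨y, ⟨y + 2 / N, by linarith [y.2.1], by linarith⟩, rfl, fun x hx => ?_⟩
      have h1 : (y : ℝ) ≤ x := hx.1
      have h2 : (x : ℝ) ≤ y + 2 / N := hx.2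
      rw [mem_closedBall, Subtype.dist_eq, Real.dist_eq]
      exact abs_le.2 ⟨by linarith, by linarith⟩
    · refine ⟨⟨y - 2 / N, by linarith, by linarith [y.2.2]⟩, y, by simp, fun x hx => ?_⟩
      have h1 : (y : ℝ) - 2 / N ≤ x := hx.1
      have h2 : (x : ℝ) ≤ y := hx.2
      rw [mem_closedBall, Subtype.dist_eq, Real.dist_eq]
      exact abs_le.2 ⟨by linarith, by linarith⟩
  have hm1 := Int.le_ceil (N * ((c : ℝ) - x₀) + 1 / 2)
  have hm2 := Int.ceil_lt_add_one (N * ((c : ℝ) - x₀) + 1 / 2)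
  have hd : N * ((d : ℝ) - x₀) = N * (c - x₀) + 2 := by
    rw [hcd]
    field_simp
    ring
  obtain ⟨p, q, hL, hpq⟩ := exists_isLap (x₀ := x₀) hN0 ⌈N * ((c : ℝ) - x₀) + 1 / 2⌉ (c := c) (d := d)
    (by linarith) (by linarith)
  exact ⟨_, p, q, hL, hpq.trans hsub⟩

section Wiggle

variable {f : C(unitI, unitI)} {x₀ a N : ℝ} {F : C(unitI, ℝ)}

/-- The wiggled map expands subintervals of laps. -/
lemma wiggle_expanding (ha₀ : 0 < a) (ha₁ : a ≤ 1 / 2) (haN : 20 ≤ a * N)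
    (hFf : ∀ x, |F x - f x| ≤ a / 10)
    (hF : ∀ x y : unitI, |F x - F y| ≤ a * N / 100 * |(x : ℝ) - y|)
    (m : ℤ) {u v : unitI} (huv : u ≤ v) (hu : m - 1 / 2 ≤ N * (u - x₀))
    (hv : N * (v - x₀) ≤ m + 1 / 2) :
    ∃ u' ∈ Icc u v, ∃ v' ∈ Icc u v,
      4 * ((v : ℝ) - u) ≤ (wiggle x₀ F a N v' : ℝ) - wiggle x₀ F a N u' := by
  have hN : 0 < N := by
    by_contra! h
    nlinarith
  have huv' : (u : ℝ) ≤ v := huv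
  have hNuv : N * ((u : ℝ) - x₀) ≤ N * (v - x₀) := by gcongr
  have hG : ∀ x, addWave x₀ F a N x ∈ Icc (-1 : ℝ) 2 :=
    fun x => addWave_mem_Icc ha₀.le ha₁ (hFf x)
  have hexp : 20 * ((v : ℝ) - u) ≤ |addWave x₀ F a N u - addWave x₀ F a N v| := by
    have hz := abs_zigzag_sub m (y := N * (u - x₀)) (z := N * (v - x₀))
      (abs_le.2 ⟨by linarith, by linarith⟩) (abs_le.2 ⟨by linarith, by linarith⟩)
    have e : |N * ((u : ℝ) - x₀) - N * (v - x₀)| = N * (v - u) := by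
      rw [abs_of_nonpos (by linarith)]
      ring
    have hFuv := hF u v
    rw [abs_sub_comm (u : ℝ), abs_of_nonneg (sub_nonneg.2 huv')] at hFuv
    have key : a * |zigzag (N * (u - x₀)) - zigzag (N * (v - x₀))| ≤
        |addWave x₀ F a N u - addWave x₀ F a N v| + |F u - F v| := by
      calc a * |zigzag (N * (u - x₀)) - zigzag (N * (v - x₀))|
          = |a * (zigzag (N * (u - x₀)) - zigzag (N * (v - x₀)))| := by
            rw [abs_mul, abs_of_pos ha₀]
        _ = |(addWave x₀ F a N u - addWave x₀ F a N v) - (F u - F v)| := by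
            rw [addWave_apply, addWave_apply]
            ring_nf
        _ ≤ _ := abs_sub _ _
    rw [hz, e] at key
    nlinarith [mul_le_mul_of_nonneg_right haN (sub_nonneg.2 huv')]
  have ivt : ∀ C ∈ Icc (min (addWave x₀ F a N u) (addWave x₀ F a N v))
      (max (addWave x₀ F a N u) (addWave x₀ F a N v)),
      ∃ x ∈ Icc u v, addWave x₀ F a N x = C := by
    intro C hC
    have hcont := (addWave x₀ F a N).continuous.continuousOn (s := Icc u v)
    rcases le_total (addWave x₀ F a N u) (addWave x₀ F a N v) with h | h
    · rw [min_eq_left h, max_eq_right h] at hC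
      exact isPreconnected_Icc.intermediate_value (left_mem_Icc.2 huv) (right_mem_Icc.2 huv)
        hcont hC
    · rw [min_eq_right h, max_eq_left h] at hC
      exact isPreconnected_Icc.intermediate_value (right_mem_Icc.2 huv) (left_mem_Icc.2 huv)
        hcont hC
  obtain ⟨C, hC, D, hD, hCD⟩ := exists_le_abs_reflect_sub
    (le_min (hG u).1 (hG v).1) min_le_max (max_le (hG u).2 (hG v).2)
  obtain ⟨s, hs, rfl⟩ := ivt C hC
  obtain ⟨t, ht, rfl⟩ := ivt D hD
  rw [max_sub_min_eq_abs, abs_sub_comm (addWave x₀ F a N v), ← coe_wiggle (hG s),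
    ← coe_wiggle (hG t)] at hCD
  replace hCD := hexp.trans hCD
  rcases le_total (wiggle x₀ F a N s : ℝ) (wiggle x₀ F a N t) with h | h
  · rw [abs_of_nonpos (sub_nonpos.2 h)] at hCD
    exact ⟨s, hs, t, ht, by linarith⟩
  · rw [abs_of_nonneg (sub_nonneg.2 h)] at hCD
    exact ⟨t, ht, s, hs, by linarith⟩

/-- The wiggled map sends each lap over a neighbourhood of its image under `F`. -/
lemma mem_wiggle_image_lap (ha₀ : 0 < a) (hN : 0 < N)
    (hF : ∀ x y : unitI, |F x - F y| ≤ a * N / 100 * |(x : ℝ) - y|)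
    {m : ℤ} {p q z y : unitI} (hL : IsLap x₀ N m p q) (hz : z ∈ Icc p q)
    (hy : |y - F z| ≤ a / 2) : y ∈ wiggle x₀ F a N '' Icc p q := by
  have hpz : (p : ℝ) ≤ z := hz.1
  have hzq : (z : ℝ) ≤ q := hz.2
  have hlen := hL.sub_eq hN
  have hosc : ∀ x ∈ Icc p q, |F x - F z| ≤ a / 100 := by
    intro x hx
    have hpx : (p : ℝ) ≤ x := hx.1
    have hxq : (x : ℝ) ≤ q := hx.2
    calc |F x - F z| ≤ a * N / 100 * |(x : ℝ) - z| := hF x z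
      _ ≤ a * N / 100 * (1 / N) := by
        gcongr
        exact abs_le.2 ⟨by linarith, by linarith⟩
      _ = a / 100 := by field_simp
  have hpq := hz.1.trans hz.2
  have hp := abs_le.1 (hosc p (left_mem_Icc.2 hpq))
  have hq := abs_le.1 (hosc q (right_mem_Icc.2 hpq))
  have hy' := abs_le.1 hy
  have hcont := (addWave x₀ F a N).continuous.continuousOn (s := Icc p q)
  have hGp : addWave x₀ F a N p = F p - a * (-1) ^ m := by
    rw [addWave_apply, hL.1, zigzag_eq m (abs_le.2 ⟨by linarith, by linarith⟩)]
    ring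
  have hGq : addWave x₀ F a N q = F q + a * (-1) ^ m := by
    rw [addWave_apply, hL.2, zigzag_eq m (abs_le.2 ⟨by linarith, by linarith⟩)]
    ring
  obtain ⟨x, hx, hxy⟩ : ∃ x ∈ Icc p q, addWave x₀ F a N x = y := by
    rcases Int.even_or_odd m with hm | hm
    · rw [hm.neg_one_zpow] at hGp hGq
      exact isPreconnected_Icc.intermediate_value (left_mem_Icc.2 hpq) (right_mem_Icc.2 hpq)
        hcont ⟨by linarith, by linarith⟩
    · rw [hm.neg_one_zpow] at hGp hGq
      exact isPreconnected_Icc.intermediate_value (right_mem_Icc.2 hpq) (left_mem_Icc.2 hpq)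
        hcont ⟨by linarith, by linarith⟩
  refine ⟨x, hx, Subtype.ext ?_⟩
  have hy2 := y.2
  rw [coe_wiggle (by rw [hxy]; exact ⟨by linarith [hy2.1], by linarith [hy2.2]⟩), hxy,
    reflect_of_mem hy2.1 hy2.2]

lemma wiggle_mem_CP (hf : f ∈ CP) (ha₀ : 0 < a) (ha₁ : a ≤ 1 / 2) (haN : 20 ≤ a * N)
    (hFf : ∀ x, |F x - f x| ≤ a / 10)
    (hF : ∀ x y : unitI, |F x - F y| ≤ a * N / 100 * |(x : ℝ) - y|) :
    wiggle x₀ F a N ∈ CP := by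
  have hN : 40 ≤ N := by
    by_contra! h
    nlinarith
  have hN0 : 0 < N := by linarith
  have hN2 : 2 / N ≤ a / 10 := by
    rw [div_le_iff₀ hN0]
    linarith
  refine mem_CP_of_expanding_of_covering hf (Lap := fun p q => p ≤ q ∧ ∃ m, IsLap x₀ N m p q)
    (ρ := 2 / N) (σ := a / 5) (by positivity) (by positivity) ?_ ?_ ?_
  · intro c d hcd
    have hcd' : (c : ℝ) < d := hcd
    have hNcd : N * ((c : ℝ) - x₀) < N * (d - x₀) := by gcongr
    obtain ⟨m, hm1, hm2⟩ : ∃ m : ℤ, m - 1 / 2 ≤ N * ((c : ℝ) - x₀) ∧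
        N * ((c : ℝ) - x₀) < m + 1 / 2 :=
      ⟨⌊N * ((c : ℝ) - x₀) + 1 / 2⌋, by linarith [Int.floor_le (N * ((c : ℝ) - x₀) + 1 / 2)],
        by linarith [Int.lt_floor_add_one (N * ((c : ℝ) - x₀) + 1 / 2)]⟩
    have shrink : ∀ u v : unitI, u ∈ Icc c d → v ∈ Icc c d → u ≤ v →
        ((d : ℝ) - c) / 2 ≤ v - u → ∀ k : ℤ, k - 1 / 2 ≤ N * ((u : ℝ) - x₀) →
        N * ((v : ℝ) - x₀) ≤ k + 1 / 2 → ∃ u ∈ Icc c d, ∃ v ∈ Icc c d,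
        2 * ((d : ℝ) - c) ≤ (wiggle x₀ F a N v : ℝ) - wiggle x₀ F a N u := by
      intro u v hu hv huv hlen k hk1 hk2
      obtain ⟨u', hu', v', hv', h⟩ := wiggle_expanding ha₀ ha₁ haN hFf hF k huv hk1 hk2
      have hsub : Icc u v ⊆ Icc c d := Icc_subset_Icc hu.1 hv.2
      exact ⟨u', hsub hu', v', hsub hv', by linarith⟩
    rcases le_total (N * ((d : ℝ) - x₀)) (m + 1 / 2) with h1 | h1
    · right
      exact shrink c d (left_mem_Icc.2 hcd.le) (right_mem_Icc.2 hcd.le) hcd.le (by linarith) m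
        hm1 h1
    rcases le_total ((m : ℝ) + 1 + 1 / 2) (N * ((d : ℝ) - x₀)) with h2 | h2
    · left
      obtain ⟨p, q, hL, hpq⟩ := exists_isLap (x₀ := x₀) hN0 (m + 1) (c := c) (d := d)
        (by push_cast; linarith) (by push_cast; linarith)
      have hle : (p : ℝ) ≤ q := by
        have := hL.sub_eq hN0
        have : 0 < 1 / N := by positivity
        linarith
      exact ⟨p, q, ⟨hle, _, hL⟩, hpq⟩
    · right
      have hce : (c : ℝ) ≤ x₀ + (m + 1 / 2) / N := by
        have : (c : ℝ) - x₀ ≤ (m + 1 / 2) / N := by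
          rw [le_div_iff₀ hN0]; linarith
        linarith
      have hed : x₀ + (m + 1 / 2) / N ≤ (d : ℝ) := by
        have : (m + 1 / 2) / N ≤ (d : ℝ) - x₀ := by
          rw [div_le_iff₀ hN0]; linarith
        linarith
      obtain ⟨e, hce, hed, he⟩ : ∃ e : unitI, c ≤ e ∧ e ≤ d ∧ N * ((e : ℝ) - x₀) = m + 1 / 2 := by
        refine ⟨⟨x₀ + (m + 1 / 2) / N, by linarith [c.2.1], by linarith [d.2.2]⟩, hce, hed, ?_⟩
        simp only [add_sub_cancel_left]
        field_simp
      rcases le_total (((d : ℝ) - c) / 2) (d - e) with h3 | h3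
      · exact shrink e d ⟨hce, hed⟩ (right_mem_Icc.2 hcd.le) hed h3 (m + 1)
          (by push_cast; linarith) (by push_cast; linarith)
      · exact shrink c e (left_mem_Icc.2 hcd.le) ⟨hce, hed⟩ hce (by linarith) m hm1 he.le
  · rintro p q ⟨hpq, m, hL⟩
    refine ⟨f p, fun y hy => mem_wiggle_image_lap ha₀ hN0 hF hL (left_mem_Icc.2 hpq) ?_⟩
    rw [mem_closedBall, Subtype.dist_eq, Real.dist_eq] at hy
    have h1 := abs_le.1 hy
    have h2 := abs_le.1 (hFf p)
    exact abs_le.2 ⟨by linarith, by linarith⟩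
  · intro y y' hy' x hx
    obtain ⟨m, p, q, hL, hpq⟩ := exists_isLap_closedBall x₀ (N := N) (by linarith) y
    have hle : p ≤ q := by
      have := hL.sub_eq hN0
      have : 0 < 1 / N := by positivity
      exact Subtype.coe_le_coe.1 (by linarith)
    refine image_mono hpq (mem_wiggle_image_lap ha₀ hN0 hF hL (left_mem_Icc.2 hle) ?_)
    have hpy := hpq (left_mem_Icc.2 hle)
    rw [mem_closedBall, Subtype.dist_eq, Real.dist_eq] at hpy hx
    rw [Subtype.dist_eq, Real.dist_eq] at hy'
    have hosc : |F p - F y| ≤ a / 50 := by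
      calc |F p - F y| ≤ a * N / 100 * |(p : ℝ) - y| := hF p y
        _ ≤ a * N / 100 * (2 / N) := by gcongr
        _ = a / 50 := by field_simp; norm_num
    have h1 := abs_le.1 hx
    have h2 := abs_le.1 hy'
    have h3 := abs_le.1 hosc
    have h4 := abs_le.1 (hFf y)
    exact abs_le.2 ⟨by linarith, by linarith⟩

lemma abs_wiggle_sub_le (ha₀ : 0 ≤ a) {x : unitI} (hG : addWave x₀ F a N x ∈ Icc (-1 : ℝ) 2)
    {y : ℝ} (hy : y ∈ Icc (0 : ℝ) 1) : |wiggle x₀ F a N x - y| ≤ a + |F x - y| := by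
  calc |wiggle x₀ F a N x - y| = |reflect (addWave x₀ F a N x) - reflect y| := by
        rw [coe_wiggle hG, reflect_of_mem hy.1 hy.2]
    _ ≤ |addWave x₀ F a N x - y| := abs_reflect_sub_le _ _
    _ ≤ |addWave x₀ F a N x - F x| + |F x - y| := abs_sub_le _ _ _
    _ ≤ a + |F x - y| := by gcongr; exact abs_addWave_sub_le x₀ F ha₀ N x

lemma coe_wiggle_self {x : unitI} (hx : F x ∈ Icc (0 : ℝ) 1) :
    (wiggle x F a N x : ℝ) = F x := by
  have e : addWave x F a N x = F x := by
    rw [addWave_apply, sub_self, mul_zero, zigzag_zero, mul_zero, add_zero]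
  rw [coe_wiggle (by rw [e]; exact ⟨by linarith [hx.1], by linarith [hx.2]⟩), e,
    reflect_of_mem hx.1 hx.2]

end Wiggle

lemma Continuous.wiggle {X : Type*} [TopologicalSpace X] (x₀ : ℝ) {F : X → C(unitI, ℝ)}
    {a N : X → ℝ} (hF : Continuous F) (ha : Continuous a) (hN : Continuous N) :
    Continuous fun t => wiggle x₀ (F t) (a t) (N t) := by
  refine ContinuousMap.continuous_of_continuous_uncurry _ ?_
  have h1 : Continuous fun z : X × unitI => F z.1 z.2 := by fun_prop
  exact (continuous_projIcc (h := zero_le_one)).comp (continuous_reflect.comp (h1.add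
    ((ha.comp continuous_fst).mul (continuous_zigzag.comp (by fun_prop)))))

/-! ### Construction of the arc -/

lemma exists_lipschitz_dist_lt (φ : C(unitI, ℝ)) {r : ℝ} (hr : 0 < r) :
    ∃ F : C(unitI, ℝ), dist F φ < r ∧
      ∃ K : ℝ, ∀ x y : unitI, |F x - F y| ≤ K * |(x : ℝ) - y| := by
  obtain ⟨p, hp⟩ := exists_polynomial_near_continuousMap 0 1 φ r hr
  have hlip : LocallyLipschitz fun x : ℝ => p.eval x :=
    ContDiff.locallyLipschitz (𝕂 := ℝ) (p.contDiff_aeval 1)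
  obtain ⟨K, hK⟩ := (hlip.locallyLipschitzOn (s := Icc (0 : ℝ) 1)).exists_lipschitzOnWith_of_compact
    isCompact_Icc
  refine ⟨p.toContinuousMapOn _, by rwa [dist_eq_norm], K, fun x y => ?_⟩
  simpa [Real.dist_eq] using hK.dist_le_mul x x.2 y y.2

/-- A continuous selection of Lipschitz approximations, together with frequencies dominating their
Lipschitz constants. -/
lemma exists_continuous_lipschitz_selection {X : Type*} [TopologicalSpace X] [NormalSpace X]
    [ParacompactSpace X] {φ : X → C(unitI, ℝ)} {r a : X → ℝ} (hφ : Continuous φ)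
    (hr : Continuous r) (ha : Continuous a) (hr₀ : ∀ s, 0 < r s) (ha₀ : ∀ s, 0 < a s) :
    ∃ F : X → C(unitI, ℝ), ∃ N : X → ℝ, Continuous F ∧ Continuous N ∧ ∀ s,
      dist (F s) (φ s) < r s ∧ 20 ≤ a s * N s ∧
      ∀ x y : unitI, |F s x - F s y| ≤ a s * N s / 100 * |(x : ℝ) - y| := by
  let T : X → Set (C(unitI, ℝ) × ℝ) := fun s =>
    (ball (φ s) (r s) ×ˢ univ) ∩ {z | 20 ≤ a s * z.2 ∧
      ∀ x y : unitI, |z.1 x - z.1 y| ≤ a s * z.2 / 100 * |(x : ℝ) - y|}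
  have hconv : ∀ s, Convex ℝ (T s) := by
    intro s
    refine ((convex_ball _ _).prod convex_univ).inter ?_
    rintro ⟨F, M⟩ ⟨hM, hF⟩ ⟨F', M'⟩ ⟨hM', hF'⟩ α β hα hβ hαβ
    refine ⟨?_, fun x y => ?_⟩
    · simp only [Prod.smul_mk, Prod.mk_add_mk, smul_eq_mul] at hM hM' ⊢
      calc (20 : ℝ) = α * 20 + β * 20 := by rw [← add_mul, hαβ, one_mul]
        _ ≤ α * (a s * M) + β * (a s * M') := by gcongr
        _ = a s * (α * M + β * M') := by ring
    · simp only [Prod.smul_mk, Prod.mk_add_mk, smul_eq_mul, ContinuousMap.add_apply,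
        ContinuousMap.smul_apply] at hF hF' ⊢
      calc |α * F x + β * F' x - (α * F y + β * F' y)|
          = |α * (F x - F y) + β * (F' x - F' y)| := by ring_nf
        _ ≤ |α * (F x - F y)| + |β * (F' x - F' y)| := abs_add_le _ _
        _ = α * |F x - F y| + β * |F' x - F' y| := by
          rw [abs_mul, abs_mul, abs_of_nonneg hα, abs_of_nonneg hβ]
        _ ≤ α * (a s * M / 100 * |(x : ℝ) - y|) + β * (a s * M' / 100 * |(x : ℝ) - y|) := by
          gcongr
          · exact hF x y
          · exact hF' x y
        _ = a s * (α * M + β * M') / 100 * |(x : ℝ) - y| := by ring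
  have hloc : ∀ s, ∃ c, ∀ᶠ s' in nhds s, c ∈ T s' := by
    intro s
    obtain ⟨F, hF, K, hK⟩ := exists_lipschitz_dist_lt (φ s) (hr₀ s)
    have has := ha₀ s
    set M := max (2 * 20 / a s) (2 * (100 * K) / a s)
    have h1 : ∀ᶠ s' in nhds s, dist F (φ s') < r s' :=
      (continuous_const.dist hφ).continuousAt.eventually_lt hr.continuousAt hF
    have h2 : ∀ᶠ s' in nhds s, a s / 2 < a s' :=
      continuousAt_const.eventually_lt ha.continuousAt (by linarith)
    refine ⟨(F, M), ?_⟩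
    filter_upwards [h1, h2] with s' hs1 hs2
    have hM1 : 2 * 20 / a s ≤ M := le_max_left _ _
    have hM2 : 2 * (100 * K) / a s ≤ M := le_max_right _ _
    rw [div_le_iff₀ has] at hM1 hM2
    have hM0 : 0 < M := by
      by_contra! h
      nlinarith
    have hmono : M * a s ≤ 2 * (a s' * M) := by nlinarith
    refine ⟨⟨hs1, mem_univ _⟩, by simp only; linarith, fun x y => (hK x y).trans ?_⟩
    gcongr
    simp only
    linarith
  obtain ⟨G, hG⟩ := exists_continuous_forall_mem_convex_of_local_const hconv hloc
  exact ⟨fun s => (G s).1, fun s => (G s).2, by fun_prop, by fun_prop,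
    fun s => ⟨(hG s).1.1, (hG s).2⟩⟩

lemma unitI_eq_zero_or_one_or_mem_Ioo (t : unitI) :
    t = 0 ∨ t = 1 ∨ ∃ s : Ioo (0 : ℝ) 1, t = ⟨s, s.2.1.le, s.2.2.le⟩ := by
  rcases eq_or_lt_of_le t.2.1 with h | h
  · exact Or.inl (Subtype.ext h.symm)
  rcases eq_or_lt_of_le t.2.2 with h' | h'
  · exact Or.inr (Or.inl (Subtype.ext h'))
  · exact Or.inr (Or.inr ⟨⟨t, h, h'⟩, rfl⟩)

/-- A path on `(0, 1)` with limits at both ends extends to `[0, 1]`. -/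
lemma exists_continuous_extension {M : Type*} [MetricSpace M] {P : Ioo (0 : ℝ) 1 → M}
    (hP : Continuous P) {f g : M} {C : ℝ} (hf : ∀ s, dist (P s) f ≤ C * s)
    (hg : ∀ s, dist (P s) g ≤ C * (1 - s)) (hfg : dist f g ≤ C) :
    ∃ γ : unitI → M, Continuous γ ∧ γ 0 = f ∧ γ 1 = g ∧
      ∀ s : Ioo (0 : ℝ) 1, γ ⟨s, s.2.1.le, s.2.2.le⟩ = P s := by
  classical
  let γ : unitI → M := fun t =>
    if h : (t : ℝ) ∈ Ioo (0 : ℝ) 1 then P ⟨t, h⟩ else if t = 0 then f else g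
  have h0 : γ 0 = f := by simp [γ]
  have h1 : γ 1 = g := by simp [γ]
  have hmid : ∀ s : Ioo (0 : ℝ) 1, γ ⟨s, s.2.1.le, s.2.2.le⟩ = P s := fun s => dif_pos s.2
  have hf' : ∀ t, dist (γ t) f ≤ C * t := by
    intro t
    rcases unitI_eq_zero_or_one_or_mem_Ioo t with rfl | rfl | ⟨s, rfl⟩
    · simp [h0]
    · simpa [h1, dist_comm] using hfg
    · rw [hmid]
      exact hf s
  have hg' : ∀ t, dist (γ t) g ≤ C * (1 - t) := by
    intro t
    rcases unitI_eq_zero_or_one_or_mem_Ioo t with rfl | rfl | ⟨s, rfl⟩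
    · simpa [h0] using hfg
    · simp [h1]
    · rw [hmid]
      exact hg s
  refine ⟨γ, continuous_iff_continuousAt.2 fun t => ?_, h0, h1, hmid⟩
  rcases unitI_eq_zero_or_one_or_mem_Ioo t with rfl | rfl | ⟨s, rfl⟩
  · rw [ContinuousAt, h0]
    refine squeeze_zero (fun _ => dist_nonneg) hf' ?_ |> tendsto_iff_dist_tendsto_zero.2
    exact Continuous.tendsto' (by fun_prop) _ _ (by simp)
  · rw [ContinuousAt, h1]
    refine squeeze_zero (fun _ => dist_nonneg) hg' ?_ |> tendsto_iff_dist_tendsto_zero.2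
    exact Continuous.tendsto' (by fun_prop) _ _ (by simp)
  · have hopen : IsOpen {t : unitI | (t : ℝ) ∈ Ioo (0 : ℝ) 1} :=
      isOpen_Ioo.preimage continuous_subtype_val
    have hon : ContinuousOn γ {t : unitI | (t : ℝ) ∈ Ioo (0 : ℝ) 1} := by
      rw [continuousOn_iff_continuous_domRestrict]
      have : Continuous fun t : {t : unitI | (t : ℝ) ∈ Ioo (0 : ℝ) 1} => P ⟨t.1, t.2⟩ :=
        hP.comp (by fun_prop)
      refine this.congr fun t => ?_
      exact (hmid ⟨t.1, t.2⟩).symm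
    exact hon.continuousAt (hopen.mem_nhds s.2)

/-- Two nearby maps in the closure of `CP` are joined by an arc whose interior lies in `CP`. -/
lemma exists_arc {f g : C(unitI, unitI)} (hf : f ∈ closure CP) (hg : g ∈ closure CP)
    (hfg : 0 < dist f g) (hfg' : dist f g ≤ 1 / 50) :
    ∃ γ : unitI → C(unitI, unitI), Continuous γ ∧ Injective γ ∧ γ 0 = f ∧ γ 1 = g ∧
      (∀ t, t = 0 ∨ t = 1 ∨ γ t ∈ CP) ∧ ∀ t, dist (γ t) f ≤ 27 * dist f g := by
  set d := dist f g with hd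
  have hne : f ≠ g := dist_pos.1 hfg
  obtain ⟨x₀, hx₀⟩ := DFunLike.ne_iff.1 hne
  have hx₀' : (f x₀ : ℝ) ≠ g x₀ := fun h => hx₀ (Subtype.ext h)
  have hfgx : ∀ x, |(f x : ℝ) - g x| ≤ d := fun x => by
    simpa [Subtype.dist_eq, Real.dist_eq] using ContinuousMap.dist_apply_le_dist (f := f) (g := g) x
  let ι : C(unitI, ℝ) := ⟨Subtype.val, continuous_subtype_val⟩
  let φ : Ioo (0 : ℝ) 1 → C(unitI, ℝ) := fun s =>
    (1 - (s : ℝ)) • ι.comp f + (s : ℝ) • ι.comp g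
  have hφ : ∀ s x, φ s x = (1 - (s : ℝ)) * f x + s * g x := fun s x => rfl
  have hφmem : ∀ s x, φ s x ∈ Icc (0 : ℝ) 1 := by
    intro s x
    rw [hφ]
    have h1 := (f x).2
    have h2 := (g x).2
    have h3 := s.2
    constructor
    · nlinarith [h1.1, h2.1, h3.1, h3.2, mul_nonneg (sub_nonneg.2 h3.2.le) h1.1,
        mul_nonneg h3.1.le h2.1]
    · nlinarith [mul_le_mul_of_nonneg_left h1.2 (sub_nonneg.2 h3.2.le),
        mul_le_mul_of_nonneg_left h2.2 h3.1.le]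
  have hφf : ∀ s x, |φ s x - f x| ≤ d * s := by
    intro s x
    have h3 := s.2
    rw [hφ, show (1 - (s : ℝ)) * f x + s * g x - f x = s * (g x - f x) by ring, abs_mul,
      abs_of_pos h3.1, abs_sub_comm, mul_comm]
    exact mul_le_mul_of_nonneg_right (hfgx x) h3.1.le
  have hφg : ∀ s x, |φ s x - g x| ≤ d * (1 - s) := by
    intro s x
    have h3 := s.2
    rw [hφ, show (1 - (s : ℝ)) * f x + s * g x - g x = (1 - s) * (f x - g x) by ring, abs_mul,
      abs_of_pos (sub_pos.2 h3.2), mul_comm]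
    exact mul_le_mul_of_nonneg_right (hfgx x) (sub_pos.2 h3.2).le
  let r : Ioo (0 : ℝ) 1 → ℝ := fun s => d * (s * (1 - s))
  have hr₀ : ∀ s, 0 < r s := fun s => mul_pos hfg (mul_pos s.2.1 (sub_pos.2 s.2.2))
  have hrs : ∀ s, r s ≤ d * s := fun s => by
    have h3 := s.2
    simp only [r]
    gcongr
    nlinarith [h3.1, h3.2]
  have hrs' : ∀ s, r s ≤ d * (1 - s) := fun s => by
    have h3 := s.2
    simp only [r]
    gcongr
    nlinarith [h3.1, h3.2]
  have hr4 : ∀ s, r s ≤ d / 4 := fun s => by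
    simp only [r]
    nlinarith [mul_nonneg hfg.le (sq_nonneg ((s : ℝ) - 1 / 2))]
  have hφc : Continuous φ := by fun_prop
  have hrc : Continuous r := by fun_prop
  obtain ⟨F₀, N, hF₀c, hNc, hsel⟩ := exists_continuous_lipschitz_selection (a := fun s => 100 * r s)
    hφc hrc (by fun_prop) hr₀ (fun s => mul_pos (by norm_num) (hr₀ s))
  let F : Ioo (0 : ℝ) 1 → C(unitI, ℝ) := fun s =>
    F₀ s + ContinuousMap.const unitI (φ s x₀ - F₀ s x₀)
  have hF : ∀ s x, F s x = F₀ s x + (φ s x₀ - F₀ s x₀) := fun s x => rfl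
  have hFc : Continuous F := by
    refine hF₀c.add (ContinuousMap.continuous_const'.comp ?_)
    fun_prop
  have hFφ : ∀ s x, |F s x - φ s x| ≤ 2 * r s := by
    intro s x
    have h1 : ∀ x, |F₀ s x - φ s x| ≤ r s := fun x =>
      (ContinuousMap.dist_apply_le_dist (f := F₀ s) (g := φ s) x).trans (hsel s).1.le
    have h2 := abs_le.1 (h1 x)
    have h3 := abs_le.1 (h1 x₀)
    rw [hF]
    exact abs_le.2 ⟨by linarith, by linarith⟩
  have hlip : ∀ s, ∀ x y : unitI, |F s x - F s y| ≤ 100 * r s * N s / 100 * |(x : ℝ) - y| := by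
    intro s x y
    rw [hF, hF, add_sub_add_right_eq_sub]
    exact (hsel s).2.2 x y
  have hnear : ∀ s, ∃ f' ∈ CP, ∀ x, |F s x - f' x| ≤ 100 * r s / 10 := by
    intro s
    have approx : ∀ k ∈ closure CP, (∀ x, |φ s x - k x| ≤ 2 * r s) →
        ∃ f' ∈ CP, ∀ x, |F s x - f' x| ≤ 100 * r s / 10 := by
      intro k hk hφk
      obtain ⟨f', hf', hdist⟩ := Metric.mem_closure_iff.1 hk (r s) (hr₀ s)
      refine ⟨f', hf', fun x => ?_⟩
      have h1 : |(k x : ℝ) - f' x| ≤ r s :=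
        (ContinuousMap.dist_apply_le_dist (f := k) (g := f') x).trans hdist.le
      have h2 := abs_le.1 h1
      have h3 := abs_le.1 (hφk x)
      have h4 := abs_le.1 (hFφ s x)
      have h5 := hr₀ s
      exact abs_le.2 ⟨by linarith, by linarith⟩
    have h3 := s.2
    rcases le_total (s : ℝ) (1 / 2) with h | h
    · refine approx f hf fun x => (hφf s x).trans ?_
      simp only [r]
      nlinarith [mul_pos hfg h3.1]
    · refine approx g hg fun x => (hφg s x).trans ?_
      simp only [r]
      nlinarith [mul_pos hfg (sub_pos.2 h3.2)]
  have ha₁ : ∀ s, 100 * r s ≤ 1 / 2 := fun s => by linarith [hr4 s]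
  have ha₀ : ∀ s, 0 < 100 * r s := fun s => mul_pos (by norm_num) (hr₀ s)
  let P : Ioo (0 : ℝ) 1 → C(unitI, unitI) := fun s => wiggle x₀ (F s) (100 * r s) (N s)
  have hPc : Continuous P := hFc.wiggle x₀ (by fun_prop) hNc
  have hPCP : ∀ s, P s ∈ CP := by
    intro s
    obtain ⟨f', hf', hFf'⟩ := hnear s
    exact wiggle_mem_CP hf' (ha₀ s) (ha₁ s) (hsel s).2.1 hFf' (hlip s)
  have hPφ : ∀ s x, |(P s x : ℝ) - φ s x| ≤ 102 * r s := by
    intro s x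
    obtain ⟨f', -, hFf'⟩ := hnear s
    have := abs_wiggle_sub_le (x₀ := x₀) (N := N s) (ha₀ s).le
      (addWave_mem_Icc (ha₀ s).le (ha₁ s) (hFf' x)) (hφmem s x)
    linarith [hFφ s x]
  have hdist : ∀ s (k : C(unitI, unitI)) (b : ℝ), (∀ x, |φ s x - k x| ≤ b) →
      dist (P s) k ≤ 102 * r s + b := by
    intro s k b hb
    have hb0 : 0 ≤ b := (abs_nonneg _).trans (hb x₀)
    refine (ContinuousMap.dist_le (by linarith [hr₀ s])).2 fun x => ?_
    rw [Subtype.dist_eq, Real.dist_eq]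
    exact (abs_sub_le _ (φ s x) _).trans (add_le_add (hPφ s x) (hb x))
  have hPf : ∀ s, dist (P s) f ≤ 103 * d * s := fun s =>
    (hdist s f _ (hφf s)).trans (by linarith [hrs s])
  have hPg : ∀ s, dist (P s) g ≤ 103 * d * (1 - s) := fun s =>
    (hdist s g _ (hφg s)).trans (by linarith [hrs' s])
  have hP27 : ∀ s, dist (P s) f ≤ 27 * d := fun s => by
    refine (hdist s f _ (hφf s)).trans ?_
    have : d * s ≤ d := mul_le_of_le_one_right hfg.le s.2.2.le
    linarith [hr4 s]
  obtain ⟨γ, hγc, hγ0, hγ1, hγP⟩ := exists_continuous_extension hPc hPf hPg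
    (by rw [← hd]; linarith)
  have heval : ∀ t, (γ t x₀ : ℝ) = f x₀ + t * (g x₀ - f x₀) := by
    intro t
    rcases unitI_eq_zero_or_one_or_mem_Ioo t with rfl | rfl | ⟨s, rfl⟩
    · simp [hγ0]
    · simp [hγ1]
    · have e : F s x₀ = φ s x₀ := by rw [hF]; ring
      rw [hγP, coe_wiggle_self (by rw [e]; exact hφmem s x₀), e, hφ]
      ring
  refine ⟨γ, hγc, fun t t' htt => Subtype.ext ?_, hγ0, hγ1, fun t => ?_, fun t => ?_⟩
  · have h1 := heval t
    rw [htt, heval t'] at h1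
    exact (mul_right_cancel₀ (sub_ne_zero.2 hx₀'.symm) (add_left_cancel h1)).symm
  · rcases unitI_eq_zero_or_one_or_mem_Ioo t with h | h | ⟨s, rfl⟩
    · exact Or.inl h
    · exact Or.inr (Or.inl h)
    · exact Or.inr (Or.inr (by rw [hγP]; exact hPCP s))
  · rcases unitI_eq_zero_or_one_or_mem_Ioo t with rfl | rfl | ⟨s, rfl⟩
    · rw [hγ0, dist_self]
      linarith
    · rw [hγ1, dist_comm, ← hd]
      linarith
    · rw [hγP]
      exact hP27 s

lemma unifLocArcwiseConnected_of_subset_closure {S : Set C(unitI, unitI)} (h₁ : CP ⊆ S)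
    (h₂ : S ⊆ closure CP) : UnifLocArcwiseConnected S := by
  intro ε hε
  refine ⟨min (1 / 50) (ε / 60), by positivity, fun f hf g hg hpos hlt => ?_⟩
  have hlt1 := hlt.trans_le (min_le_left _ _)
  have hlt2 := hlt.trans_le (min_le_right _ _)
  obtain ⟨γ, hc, hinj, h0, h1, hCP, hdist⟩ := exists_arc (h₂ hf) (h₂ hg) hpos hlt1.le
  refine ⟨γ, hc, hinj, h0, h1, ?_, ?_⟩
  · rintro _ ⟨t, rfl⟩
    rcases hCP t with rfl | rfl | h
    · rwa [h0]
    · rwa [h1]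
    · exact h₁ h
  · refine lt_of_le_of_lt (Metric.diam_le_of_forall_dist_le (C := 54 * dist f g) (by positivity) ?_)
      (by linarith)
    rintro _ ⟨t, rfl⟩ _ ⟨t', rfl⟩
    linarith [dist_triangle_right (γ t) (γ t') f, hdist t, hdist t']

/-- Both `CP` and `cl(CP)` (with the uniform metric) are uniformly locally arcwise
connected. -/
theorem CP_and_closure_unifLocArcwiseConnected :
    UnifLocArcwiseConnected CP ∧ UnifLocArcwiseConnected (closure CP) := by
  exact ⟨unifLocArcwiseConnected_of_subset_closure Subset.rfl subset_closure,
    unifLocArcwiseConnected_of_subset_closure subset_closure Subset.rfl⟩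
end
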